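/- There is an absolute constant ε > 0 such that every graph on n ≥ 16 vertices whose average degree d satisfies d ≥ 2·log₂ log₂ n has a 64-almost-regular subgraph with average degree at least ε·(d/log₂ log₂ n)^{1/4}/(log₂(d/log₂ log₂ n))^{1/2}. -/

import Mathlib

variable {V : Type*}

/-- `G` is a bipartite graph with parts `A` and `B`: the parts are disjoint, cover all
vertices, and every edge goes between `A` and `B`. -/
def BipartiteWith (G : SimpleGraph V) (A B : Set V) : Prop :=
  Disjoint A B ∧ A ∪ B = Set.univ ∧
    ∀ ⦃u v : V⦄, G.Adj u v → (u ∈ A ∧ v ∈ B) ∨ (u ∈ B ∧ v ∈ A)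

/-- `G` contains no complete bipartite subgraph `K_{k,k}`. -/
def KkkFree (G : SimpleGraph V) (k : ℕ) : Prop :=
  ¬ ∃ (S T : Finset V), Disjoint S T ∧ S.card = k ∧ T.card = k ∧
      ∀ u ∈ S, ∀ v ∈ T, G.Adj u v

/-- The number of edges of `G`. -/
noncomputable def edgeCount (G : SimpleGraph V) : ℕ := G.edgeSet.ncard

/-- The degree of `v` in `G`. -/
noncomputable def deg (G : SimpleGraph V) (v : V) : ℕ := (G.neighborSet v).ncard

/-- The codegree of `u` and `u'` in `G`: the number of their common neighbours. -/
noncomputable def codeg (G : SimpleGraph V) (u u' : V) : ℕ :=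
  (G.neighborSet u ∩ G.neighborSet u').ncard

/-- The average degree of `G`, as a real number. -/
noncomputable def avgDeg [Fintype V] (G : SimpleGraph V) : ℝ :=
  2 * (edgeCount G : ℝ) / (Fintype.card V : ℝ)

/-- The number of edges of a subgraph. -/
noncomputable def subEdgeCount {G : SimpleGraph V} (H : G.Subgraph) : ℕ := H.edgeSet.ncard

/-- The degree of a vertex in a subgraph. -/
noncomputable def subDeg {G : SimpleGraph V} (H : G.Subgraph) (v : V) : ℕ :=
  (H.neighborSet v).ncard

/-- The average degree of a subgraph. -/
noncomputable def subAvgDeg {G : SimpleGraph V} (H : G.Subgraph) : ℝ :=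
  2 * (subEdgeCount H : ℝ) / (H.verts.ncard : ℝ)

/-- A subgraph `H` is `K`-almost-regular: its maximum degree is at most `K` times its
minimum degree. -/
def SubAlmostRegular {G : SimpleGraph V} (H : G.Subgraph) (K : ℝ) : Prop :=
  ∀ v ∈ H.verts, ∀ w ∈ H.verts, (subDeg H v : ℝ) ≤ K * (subDeg H w : ℝ)

/-- `G` has a nonempty `k`-regular subgraph. -/
def HasRegularSubgraph (G : SimpleGraph V) (k : ℕ) : Prop :=
  ∃ H : G.Subgraph, H.verts.Nonempty ∧ ∀ v ∈ H.verts, subDeg H v = k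

/-- `G` has a nonempty `K`-almost-regular subgraph with average degree at least `c`. -/
def HasAlmostRegularSubgraph (G : SimpleGraph V) (K : ℝ) (c : ℝ) : Prop :=
  ∃ H : G.Subgraph, H.verts.Nonempty ∧ SubAlmostRegular H K ∧ c ≤ subAvgDeg H

/-- `G` is `(L, d)`-almost-biregular with parts `A` and `B`. -/
def IsAlmostBiregular (G : SimpleGraph V) (A B : Set V) (L : ℝ) (d : ℕ) : Prop :=
  BipartiteWith G A B ∧ A.Nonempty ∧
    (∀ v ∈ B, deg G v = d) ∧
    (d : ℝ) ≤ (edgeCount G : ℝ) / (A.ncard : ℝ) ∧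
    ∀ u ∈ A, (deg G u : ℝ) ≤ L * ((edgeCount G : ℝ) / (A.ncard : ℝ))

/-- A subgraph `H` of `G` is `(L, d)`-almost-biregular with parts `A` and `B`. -/
def SubIsAlmostBiregular {G : SimpleGraph V} (H : G.Subgraph) (A B : Set V)
    (L : ℝ) (d : ℕ) : Prop :=
  Disjoint A B ∧ A ∪ B = H.verts ∧
    (∀ ⦃u v : V⦄, H.Adj u v → (u ∈ A ∧ v ∈ B) ∨ (u ∈ B ∧ v ∈ A)) ∧
    A.Nonempty ∧
    (∀ v ∈ B, subDeg H v = d) ∧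
    (d : ℝ) ≤ (subEdgeCount H : ℝ) / (A.ncard : ℝ) ∧
    ∀ u ∈ A, (subDeg H u : ℝ) ≤ L * ((subEdgeCount H : ℝ) / (A.ncard : ℝ))

open Finset in
/-- A bipartite incidence structure (`b ∈ B` is joined to the elements of `N b`) has a
substructure of maximum degree at most `r` with more than `r / 20` edges per vertex. -/
def HasBalancedSub {α β : Type*} [DecidableEq α] (N : β → Finset α) (B : Finset β) (r : ℕ) :
    Prop :=
  ∃ (A' : Finset α) (B' : Finset β) (N' : β → Finset α),
    B' ⊆ B ∧ (∀ b ∈ B', N' b ⊆ N b) ∧ (∀ b ∈ B', N' b ⊆ A') ∧ (∀ b ∈ B', #(N' b) ≤ r) ∧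
    (∀ a ∈ A', #{b ∈ B' | a ∈ N' b} ≤ r) ∧ r * (#A' + #B') < 20 * ∑ b ∈ B', #(N' b)

section Bipartite

open Finset

variable {α β γ : Type*} [DecidableEq α] [DecidableEq β] [DecidableEq γ]

omit [DecidableEq β] in
lemma HasBalancedSub.mono {N N₁ : β → Finset α} {B B₁ : Finset β} {r : ℕ}
    (h : HasBalancedSub N₁ B₁ r) (hB : B₁ ⊆ B) (hN : ∀ b ∈ B₁, N₁ b ⊆ N b) :
    HasBalancedSub N B r := by
  obtain ⟨A', B', N', h1, h2, h3⟩ := h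
  exact ⟨A', B', N', h1.trans hB, fun b hb => (h2 b hb).trans (hN b (h1 hb)), h3⟩

omit [DecidableEq β] in
lemma sum_degree_eq {A : Finset α} {B : Finset β} {N : β → Finset α}
    (hN : ∀ b ∈ B, N b ⊆ A) : ∑ a ∈ A, #{b ∈ B | a ∈ N b} = ∑ b ∈ B, #(N b) := by
  have := sum_card_bipartiteAbove_eq_sum_card_bipartiteBelow (s := A) (t := B)
    (fun a b => a ∈ N b)
  simp only [bipartiteAbove, bipartiteBelow] at this
  rw [this]
  refine sum_congr rfl fun b hb => ?_
  rw [filter_mem_eq_inter, inter_eq_right.2 (hN b hb)]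

/-- The probability of drawing `S` when each `x ∈ U` is kept independently with
probability `p x`. -/
noncomputable def bernoulliWeight (U : Finset γ) (p : γ → ℝ) (S : Finset γ) : ℝ :=
  (∏ x ∈ S, p x) * ∏ x ∈ U \ S, (1 - p x)

lemma bernoulliWeight_nonneg {U S : Finset γ} {p : γ → ℝ} (hp : ∀ x ∈ U, 0 ≤ p x ∧ p x ≤ 1)
    (hS : S ∈ U.powerset) : 0 ≤ bernoulliWeight U p S :=
  mul_nonneg (prod_nonneg fun x hx => (hp x (mem_powerset.1 hS hx)).1)
    (prod_nonneg fun x hx => sub_nonneg.2 (hp x (mem_sdiff.1 hx).1).2)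

lemma sum_bernoulliWeight_of_subset {U X : Finset γ} (p : γ → ℝ) (hX : X ⊆ U) :
    ∑ S ∈ U.powerset, bernoulliWeight U p S * (if X ⊆ S then 1 else 0) = ∏ x ∈ X, p x := by
  have h := prod_add p (fun x => if x ∈ X then 0 else 1 - p x) U
  have h1 : ∏ x ∈ U, (p x + if x ∈ X then 0 else 1 - p x) = ∏ x ∈ X, p x := by
    rw [← prod_subset hX (f := fun x => p x + if x ∈ X then 0 else 1 - p x)]
    · exact prod_congr rfl fun x hx => by simp [hx]
    · intro x _ hx; simp [hx]
  rw [← h1, h]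
  refine sum_congr rfl fun S hS => ?_
  unfold bernoulliWeight
  split_ifs with hXS
  · rw [mul_one]
    congr 1
    refine prod_congr rfl fun x hx => ?_
    rw [if_neg fun hxX => (mem_sdiff.1 hx).2 (hXS hxX)]
  · obtain ⟨x, hxX, hxS⟩ := not_subset.1 hXS
    have h0 : ∏ x ∈ U \ S, (if x ∈ X then 0 else 1 - p x) = 0 :=
      prod_eq_zero (mem_sdiff.2 ⟨hX hxX, hxS⟩) (if_pos hxX)
    rw [h0, mul_zero, mul_zero]

/-- First and second moment method: a random induced substructure, given by the weighted
outcomes `w`, in which every `a` has conditional expected degree `r / 8`. -/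
lemma hasBalancedSub_of_moments {ι : Type*} {A : Finset α} {B : Finset β} {N : β → Finset α}
    {r : ℕ} {Ω : Finset ι} {w : ι → ℝ} (hw : ∀ i ∈ Ω, 0 ≤ w i)
    {PA : ι → Finset α} {PB : ι → Finset β} {p : α → ℝ} {ρ : ℝ}
    (hr : 0 < r) (hρ : 0 < ρ) (hB : B.Nonempty)
    (hNA : ∀ b ∈ B, N b ⊆ A) (hNr : ∀ b ∈ B, #(N b) ≤ r)
    (hPB : ∀ i ∈ Ω, PB i ⊆ B) (hPA : ∀ i ∈ Ω, PA i ⊆ A)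
    (hNP : ∀ i ∈ Ω, ∀ b ∈ PB i, N b ⊆ PA i)
    (he : r * #B ≤ 4 * ∑ b ∈ B, #(N b))
    (hA1 : ∀ a ∈ A, ∑ i ∈ Ω, w i * (if a ∈ PA i then 1 else 0) = p a)
    (hB1 : ∀ b ∈ B, ∑ i ∈ Ω, w i * (if b ∈ PB i then 1 else 0) = ρ)
    (hdeg : ∀ a ∈ A, 8 * (ρ * #{b ∈ B | a ∈ N b}) = r * p a)
    (hB2 : ∀ a ∈ A, 64 * ∑ b ∈ B with a ∈ N b, ∑ b' ∈ B with a ∈ N b',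
      ∑ i ∈ Ω, w i * ((if b ∈ PB i then 1 else 0) * (if b' ∈ PB i then 1 else 0))
        ≤ 3 * r ^ 2 * p a) :
    HasBalancedSub N B r := by
  have hr' : (0 : ℝ) < r := by exact_mod_cast hr
  set deg : ι → α → ℝ := fun i a => ∑ b ∈ B with a ∈ N b, if b ∈ PB i then 1 else 0 with hdegdef
  have hdegcard : ∀ i ∈ Ω, ∀ a, deg i a = #{b ∈ PB i | a ∈ N b} := by
    intro i hi a
    simp only [hdegdef, sum_boole]
    congr 2
    ext b
    simp only [mem_filter]
    constructor
    · rintro ⟨⟨_, h1⟩, h2⟩; exact ⟨h2, h1⟩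
    · rintro ⟨h2, h1⟩; exact ⟨⟨hPB i hi h2, h1⟩, h2⟩
  have hd1 : ∀ a ∈ A, ∑ i ∈ Ω, w i * deg i a = r / 8 * p a := by
    intro a ha
    simp only [hdegdef, mul_sum]
    rw [sum_comm]
    rw [sum_congr rfl fun b hb => hB1 b (mem_filter.1 hb).1, sum_const, nsmul_eq_mul]
    have := hdeg a ha
    linarith
  have hd2 : ∀ a ∈ A, ∑ i ∈ Ω, w i * deg i a ^ 2 ≤ 3 * r ^ 2 / 64 * p a := by
    intro a ha
    have h := hB2 a ha
    have h2 : ∑ i ∈ Ω, w i * deg i a ^ 2 = ∑ b ∈ B with a ∈ N b, ∑ b' ∈ B with a ∈ N b',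
      ∑ i ∈ Ω, w i * ((if b ∈ PB i then 1 else 0) * (if b' ∈ PB i then 1 else 0)) := by
      have h3 : ∀ i, w i * deg i a ^ 2 = ∑ b ∈ B with a ∈ N b, ∑ b' ∈ B with a ∈ N b',
          w i * ((if b ∈ PB i then 1 else 0) * (if b' ∈ PB i then 1 else 0)) := by
        intro i
        rw [sq, hdegdef, sum_mul_sum, mul_sum]
        exact sum_congr rfl fun b _ => mul_sum ..
      rw [sum_congr rfl fun i _ => h3 i, sum_comm]
      exact sum_congr rfl fun b _ => sum_comm
    rw [h2]; linarith
  have hsumdeg : ρ * ∑ b ∈ B, (#(N b) : ℝ) = r / 8 * ∑ a ∈ A, p a := by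
    have h := sum_degree_eq hNA
    have h' : ∑ b ∈ B, (#(N b) : ℝ) = ∑ a ∈ A, (#{b ∈ B | a ∈ N b} : ℝ) := by
      exact_mod_cast h.symm
    rw [h', mul_sum, mul_sum]
    refine sum_congr rfl fun a ha => ?_
    linarith [hdeg a ha]
  have he' : (r : ℝ) * #B ≤ 4 * ∑ b ∈ B, (#(N b) : ℝ) := by exact_mod_cast he
  have hBpos : (0 : ℝ) < #B := by exact_mod_cast hB.card_pos
  have hpos : 0 < ∑ i ∈ Ω, w i * (20 * ∑ a ∈ A, (deg i a - deg i a ^ 2 / r)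
      - r * (#(PA i) + #(PB i))) := by
    have e1 : ∑ i ∈ Ω, w i * (#(PA i) : ℝ) = ∑ a ∈ A, p a := by
      rw [← sum_congr rfl hA1, sum_comm]
      refine sum_congr rfl fun i hi => ?_
      rw [← mul_sum, sum_boole, filter_mem_eq_inter, inter_eq_right.2 (hPA i hi)]
    have e2 : ∑ i ∈ Ω, w i * (#(PB i) : ℝ) = ρ * #B := by
      have : ρ * #B = ∑ b ∈ B, ρ := by simp [mul_comm]
      rw [this, ← sum_congr rfl hB1, sum_comm]
      refine sum_congr rfl fun i hi => ?_
      rw [← mul_sum, sum_boole, filter_mem_eq_inter, inter_eq_right.2 (hPB i hi)]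
    have e3 : 5 * r / 64 * ∑ a ∈ A, p a
        ≤ ∑ i ∈ Ω, w i * ∑ a ∈ A, (deg i a - deg i a ^ 2 / r) := by
      simp only [mul_sum]
      rw [sum_comm]
      refine sum_le_sum fun a ha => ?_
      have : ∑ i ∈ Ω, w i * (deg i a - deg i a ^ 2 / r)
          = ∑ i ∈ Ω, w i * deg i a - (∑ i ∈ Ω, w i * deg i a ^ 2) / r := by
        rw [sum_div, ← sum_sub_distrib]
        exact sum_congr rfl fun i _ => by ring
      rw [this, hd1 a ha]
      have h := div_le_div_of_nonneg_right (hd2 a ha) hr'.le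
      have h3 : 3 * (r : ℝ) ^ 2 / 64 * p a / r = 3 * r / 64 * p a := by field_simp
      rw [h3] at h
      linarith
    have e4 : ∑ i ∈ Ω, w i * (20 * ∑ a ∈ A, (deg i a - deg i a ^ 2 / r)
        - r * (#(PA i) + #(PB i))) = 20 * ∑ i ∈ Ω, w i * ∑ a ∈ A, (deg i a - deg i a ^ 2 / r)
        - r * (∑ i ∈ Ω, w i * (#(PA i) : ℝ) + ∑ i ∈ Ω, w i * (#(PB i) : ℝ)) := by
      rw [← sum_add_distrib, mul_sum, mul_sum, ← sum_sub_distrib]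
      exact sum_congr rfl fun i _ => by ring
    rw [e4, e1, e2]
    have h5 : r * (ρ * #B) ≤ r / 2 * ∑ a ∈ A, p a := by
      have := mul_le_mul_of_nonneg_left he' hρ.le
      nlinarith
    have h6 : 0 < r * (ρ * #B) := by positivity
    nlinarith
  obtain ⟨i, hi, hwi⟩ := exists_lt_of_sum_lt (s := Ω) (f := fun _ => (0 : ℝ))
    (by simpa only [sum_const_zero] using hpos)
  have hgood : r * ((#(PA i) : ℝ) + #(PB i)) < 20 * ∑ a ∈ A, (deg i a - deg i a ^ 2 / r) := by
    by_contra! hcon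
    have := mul_nonneg (hw i hi) (sub_nonneg.2 hcon)
    linarith
  refine ⟨PA i, PB i, fun b => {a ∈ N b | #{b ∈ PB i | a ∈ N b} ≤ r}, hPB i hi,
    fun b _ => filter_subset _ _, fun b hb => (filter_subset _ _).trans (hNP i hi b hb),
    fun b hb => (card_le_card (filter_subset _ _)).trans (hNr b (hPB i hi hb)),
    fun a _ => ?_, ?_⟩
  · by_cases h : #{b ∈ PB i | a ∈ N b} ≤ r
    · refine (card_le_card ?_).trans h
      intro b hb
      simp only [mem_filter] at hb ⊢
      exact ⟨hb.1, hb.2.1⟩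
    · simp [h]
  · have h1 : ∑ a ∈ A, (deg i a - deg i a ^ 2 / r)
        ≤ ∑ b ∈ PB i, (#{a ∈ N b | #{b ∈ PB i | a ∈ N b} ≤ r} : ℝ) := by
      have h := sum_degree_eq (A := A) (B := PB i)
        (N := fun b => {a ∈ N b | #{b ∈ PB i | a ∈ N b} ≤ r})
        (fun b hb => (filter_subset _ _).trans (hNA b (hPB i hi hb)))
      have h' : ∑ b ∈ PB i, (#{a ∈ N b | #{b ∈ PB i | a ∈ N b} ≤ r} : ℝ) = ∑ a ∈ A,
          (#{b ∈ PB i | a ∈ ({a ∈ N b | #{b ∈ PB i | a ∈ N b} ≤ r} : Finset α)} : ℝ) := by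
        exact_mod_cast h.symm
      rw [h']
      refine sum_le_sum fun a _ => ?_
      rw [hdegcard i hi a]
      by_cases hle : #{b ∈ PB i | a ∈ N b} ≤ r
      · simp only [mem_filter, hle, and_true]
        have : (0 : ℝ) ≤ (#{b ∈ PB i | a ∈ N b} : ℝ) ^ 2 / r := by positivity
        linarith
      · have hlt : (r : ℝ) < #{b ∈ PB i | a ∈ N b} := by exact_mod_cast not_le.1 hle
        have : (#{b ∈ PB i | a ∈ N b} : ℝ) ≤ (#{b ∈ PB i | a ∈ N b} : ℝ) ^ 2 / r := by
          rw [le_div_iff₀ hr']; nlinarith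
        refine le_trans ?_ (Nat.cast_nonneg _)
        linarith
    have h2 : (r : ℝ) * ((#(PA i) : ℝ) + #(PB i))
        < 20 * ∑ b ∈ PB i, (#{a ∈ N b | #{b ∈ PB i | a ∈ N b} ≤ r} : ℝ) := by linarith
    exact_mod_cast h2

/-- Keep each `a` with probability `p a`, and each `b` all of whose neighbours are kept with
probability `q b`; if every `b` survives with the same probability `ρ` and every `a` has
conditional expected degree `r / 8`, a second moment bound yields a balanced substructure. -/
lemma hasBalancedSub_of_sampling {A : Finset α} {B : Finset β} {N : β → Finset α} {r : ℕ}
    {p : α → ℝ} {q : β → ℝ} {ρ : ℝ} (hr : 0 < r) (hρ : 0 < ρ) (hB : B.Nonempty)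
    (hNA : ∀ b ∈ B, N b ⊆ A) (hNr : ∀ b ∈ B, #(N b) ≤ r)
    (he : r * #B ≤ 4 * ∑ b ∈ B, #(N b))
    (hp : ∀ a ∈ A, 0 < p a ∧ p a ≤ 1) (hq : ∀ b ∈ B, 0 ≤ q b ∧ q b ≤ 1)
    (hpq : ∀ b ∈ B, (∏ a ∈ N b, p a) * q b = ρ)
    (hdeg : ∀ a ∈ A, 8 * (ρ * #{b ∈ B | a ∈ N b}) = r * p a)
    (h2 : ∀ a ∈ A, 64 * ∑ b ∈ B with a ∈ N b, ∑ b' ∈ B with a ∈ N b',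
      (if b = b' then ρ else ρ ^ 2 / ∏ x ∈ N b ∩ N b', p x) ≤ 3 * r ^ 2 * p a) :
    HasBalancedSub N B r := by
  set U : Finset (α ⊕ β) := A.disjSum B
  set P : α ⊕ β → ℝ := Sum.elim p q
  set X : β → Finset (α ⊕ β) := fun b => (N b).disjSum {b}
  have hP : ∀ x ∈ U, 0 ≤ P x ∧ P x ≤ 1 := by
    rintro (a | b) hx
    · exact ⟨(hp a (inl_mem_disjSum.1 hx)).1.le, (hp a (inl_mem_disjSum.1 hx)).2⟩
    · exact hq b (inr_mem_disjSum.1 hx)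
  have hXU : ∀ b ∈ B, X b ⊆ U := fun b hb =>
    disjSum_mono (hNA b hb) (singleton_subset_iff.2 hb)
  have hPX : ∀ b ∈ B, ∏ x ∈ X b, P x = ρ := by
    intro b hb
    simp only [X, P, prod_disjSum, Sum.elim_inl, Sum.elim_inr, prod_singleton]
    exact hpq b hb
  refine hasBalancedSub_of_moments (A := A) (Ω := U.powerset) (w := bernoulliWeight U P)
    (PA := fun S => {a ∈ A | Sum.inl a ∈ S}) (PB := fun S => {b ∈ B | X b ⊆ S}) (p := p)
    (fun S hS => bernoulliWeight_nonneg hP hS) hr hρ hB hNA hNr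
    (fun S _ => filter_subset _ _) (fun S _ => filter_subset _ _) ?_ he ?_ ?_ hdeg ?_
  · intro S _ b hb a ha
    obtain ⟨hbB, hbS⟩ := mem_filter.1 hb
    exact mem_filter.2 ⟨hNA b hbB ha, hbS (inl_mem_disjSum.2 ha)⟩
  · intro a ha
    have h := sum_bernoulliWeight_of_subset (U := U) (X := {Sum.inl a}) P
      (singleton_subset_iff.2 (inl_mem_disjSum.2 ha))
    simp only [singleton_subset_iff, prod_singleton] at h
    simp only [mem_filter, ha, true_and]
    exact h
  · intro b hb
    simp only [mem_filter, hb, true_and]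
    rw [sum_bernoulliWeight_of_subset P (hXU b hb), hPX b hb]
  · intro a ha
    refine le_trans (le_of_eq ?_) (h2 a ha)
    congr 1
    refine sum_congr rfl fun b hb => sum_congr rfl fun b' hb' => ?_
    have hbB := (mem_filter.1 hb).1
    have hbB' := (mem_filter.1 hb').1
    simp only [mem_filter, hbB, hbB', true_and]
    have h1 : ∀ S, ((if X b ⊆ S then (1 : ℝ) else 0) * (if X b' ⊆ S then 1 else 0))
        = if X b ∪ X b' ⊆ S then 1 else 0 := by
      intro S
      simp only [union_subset_iff]
      by_cases h : X b ⊆ S <;> by_cases h' : X b' ⊆ S <;> simp [h, h']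
    simp only [h1]
    rw [sum_bernoulliWeight_of_subset P (union_subset (hXU b hbB) (hXU b' hbB'))]
    split_ifs with hbb
    · subst hbb; rw [union_self, hPX b hbB]
    · have hI : X b ∩ X b' = (N b ∩ N b').disjSum ∅ := by
        ext (x | x)
        · simp [X]
        · simp only [X, mem_inter, inr_mem_disjSum, mem_singleton, notMem_empty, iff_false]
          rintro ⟨rfl, h⟩; exact hbb h
      have h3 := prod_union_inter (s₁ := X b) (s₂ := X b') (f := P)
      rw [hPX b hbB, hPX b' hbB', hI, prod_disjSum] at h3
      simp only [P, Sum.elim_inl, prod_empty, mul_one] at h3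
      rw [eq_div_iff, sq, ← h3]
      exact (prod_pos fun x hx => (hp x (hNA b hbB (mem_inter.1 hx).1)).1).ne'

/-- The sampling lemma when all `a` have the same degree: only `B` has to be sampled. -/
lemma hasBalancedSub_of_constant_degree {A : Finset α} {B : Finset β} {N : β → Finset α}
    {r t : ℕ} (hr : 8 ≤ r) (ht : r ≤ 8 * t) (hB : B.Nonempty)
    (hNA : ∀ b ∈ B, N b ⊆ A) (hNr : ∀ b ∈ B, #(N b) ≤ r)
    (hdeg : ∀ a ∈ A, #{b ∈ B | a ∈ N b} = t) (he : r * #B ≤ 4 * (t * #A)) :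
    HasBalancedSub N B r := by
  have hr' : (8 : ℝ) ≤ r := by exact_mod_cast hr
  have ht0 : (0 : ℝ) < t := by
    have : 0 < t := by omega
    exact_mod_cast this
  have ht' : (r : ℝ) ≤ 8 * t := by exact_mod_cast ht
  have hsum : ∑ b ∈ B, #(N b) = t * #A := by
    rw [← sum_degree_eq hNA, sum_congr rfl hdeg, sum_const, smul_eq_mul, mul_comm]
  set ρ : ℝ := r / (8 * t) with hρ
  have hρ0 : 0 < ρ := by positivity
  have hρ1 : ρ ≤ 1 := by rw [hρ, div_le_one (by positivity)]; exact ht'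
  have hρt : 8 * (ρ * t) = r := by rw [hρ]; field_simp
  refine hasBalancedSub_of_sampling (p := fun _ => 1) (q := fun _ => ρ) (ρ := ρ)
    (by omega) hρ0 hB hNA hNr (by rw [hsum]; exact he) (fun _ _ => by norm_num)
    (fun _ _ => ⟨hρ0.le, hρ1⟩) (fun _ _ => by simp) (fun a ha => by rw [hdeg a ha]; simpa) ?_
  intro a ha
  simp only [prod_const_one, div_one, mul_one]
  have h1 : ∀ b ∈ B.filter (fun b => a ∈ N b),
      ∑ b' ∈ B with a ∈ N b', (if b = b' then ρ else ρ ^ 2) ≤ ρ + t * ρ ^ 2 := by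
    intro b hb
    calc ∑ b' ∈ B with a ∈ N b', (if b = b' then ρ else ρ ^ 2)
        ≤ ∑ b' ∈ B with a ∈ N b', ((if b = b' then ρ else 0) + ρ ^ 2) := by
          refine sum_le_sum fun b' _ => ?_
          split_ifs
          · nlinarith
          · linarith
      _ = ρ + t * ρ ^ 2 := by
          rw [sum_add_distrib, sum_ite_eq, if_pos hb, sum_const, hdeg a ha, nsmul_eq_mul]
  have h2 := sum_le_sum h1
  rw [sum_const, hdeg a ha, nsmul_eq_mul] at h2
  have h3 : 64 * ((t : ℝ) * (ρ + t * ρ ^ 2)) = 8 * r + r ^ 2 := by rw [← hρt]; ring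
  nlinarith

omit [DecidableEq β] in
/-- A maximal family of vertex-stars with `t` leaves covering each `b` at most `r` times. -/
lemma exists_maximal_stars (A : Finset α) (B : Finset β) (N : β → Finset α) (r t : ℕ) :
    ∃ (S : Finset α) (N' : β → Finset α), S ⊆ A ∧ (∀ b, N' b ⊆ N b) ∧ (∀ b, N' b ⊆ S) ∧
      (∀ b, #(N' b) ≤ r) ∧ (∀ a ∈ S, #{b ∈ B | a ∈ N' b} = t) ∧
      ∀ a ∈ A \ S, #{b ∈ B | a ∈ N b ∧ #(N' b) < r} < t := by
  classical
  set F : Finset (Finset α) := {S ∈ A.powerset | ∃ N' : β → Finset α, (∀ b, N' b ⊆ N b) ∧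
    (∀ b, N' b ⊆ S) ∧ (∀ b, #(N' b) ≤ r) ∧ (∀ a ∈ S, #{b ∈ B | a ∈ N' b} = t)} with hF
  have hne : F.Nonempty := ⟨∅, by
    rw [hF, mem_filter]
    exact ⟨by simp, fun _ => ∅, by simp⟩⟩
  obtain ⟨S, hS, hmax⟩ := exists_max_image F card hne
  obtain ⟨hSA, N', h1, h2, h3, h4⟩ := mem_filter.1 hS
  refine ⟨S, N', mem_powerset.1 hSA, h1, h2, h3, h4, fun a ha => ?_⟩
  obtain ⟨haA, haS⟩ := mem_sdiff.1 ha
  by_contra! hcon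
  obtain ⟨T, hT, hTt⟩ := exists_subset_card_eq hcon
  have haN' : ∀ b, a ∉ N' b := fun b hb => haS (h2 b hb)
  have hins : insert a S ∈ F := by
    rw [hF, mem_filter, mem_powerset]
    refine ⟨insert_subset haA (mem_powerset.1 hSA),
      fun b => if b ∈ T then insert a (N' b) else N' b, ?_, ?_, ?_, ?_⟩
    · intro b
      dsimp only
      split_ifs with hb
      · exact insert_subset (mem_filter.1 (hT hb)).2.1 (h1 b)
      · exact h1 b
    · intro b
      dsimp only
      split_ifs with hb
      · exact insert_subset_insert _ (h2 b)
      · exact (h2 b).trans (subset_insert _ _)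
    · intro b
      dsimp only
      split_ifs with hb
      · rw [card_insert_of_notMem (haN' b)]
        exact (mem_filter.1 (hT hb)).2.2
      · exact h3 b
    · intro x hx
      by_cases hxa : x = a
      · subst hxa
        rw [← hTt]
        congr 1
        ext b
        simp only [mem_filter]
        constructor
        · rintro ⟨_, hb⟩
          split_ifs at hb with hbT
          · exact hbT
          · exact absurd hb (haN' b)
        · intro hb
          exact ⟨(mem_filter.1 (hT hb)).1, by simp [hb]⟩
      · rw [← h4 x ((mem_insert.1 hx).resolve_left hxa)]
        congr 1
        ext b
        simp only [mem_filter]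
        split_ifs <;> simp [hxa]
  have := hmax _ hins
  rw [card_insert_of_notMem haS] at this
  omega

/-- If the degrees on the `A` side are bounded by `Δ`, it suffices that the degrees on the
`B` side exceed a constant times `r * log Δ`. -/
lemma hasBalancedSub_of_degree_le {r : ℕ} (hr : 8 ≤ r) (Δ j : ℕ) :
    ∀ (A : Finset α) (B : Finset β) (N : β → Finset α), B.Nonempty → (∀ b ∈ B, N b ⊆ A) →
      (∀ b ∈ B, 12 * r * j + 1 ≤ #(N b)) → (∀ a ∈ A, #{b ∈ B | a ∈ N b} ≤ Δ) →
      Δ * #A < 2 ^ j * #B → #A ≤ 2 * #B → HasBalancedSub N B r := by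
  induction j with
  | zero =>
    intro A B N hB hNA hd hΔ hlt _
    have h1 := sum_degree_eq hNA
    have h2 : ∑ a ∈ A, #{b ∈ B | a ∈ N b} ≤ #A * Δ := sum_le_card_nsmul _ _ _ hΔ
    have h3 : #B * 1 ≤ ∑ b ∈ B, #(N b) := card_nsmul_le_sum _ _ _ fun b hb => by
      have := hd b hb; omega
    rw [mul_comm] at h2
    simp only [pow_zero, one_mul, mul_one] at *
    omega
  | succ j ih =>
    intro A B N hB hNA hd hΔ hlt hAB
    have hA : 0 < #A := by
      obtain ⟨b, hb⟩ := hB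
      have h1 := hd b hb
      have h2 := card_le_card (hNA b hb)
      omega
    set t := 2 * r * #B / #A with ht
    have ht1 : t * #A ≤ 2 * r * #B := Nat.div_mul_le_self _ _
    have ht2 : 2 * r * #B < (t + 1) * #A := by
      rw [mul_comm (t + 1)]; exact Nat.lt_mul_div_succ _ hA
    have htr : r ≤ t := (Nat.le_div_iff_mul_le hA).2 (by nlinarith)
    obtain ⟨S, N', hSA, hN'N, hN'S, hN'r, hN't, hmax⟩ := exists_maximal_stars A B N r t
    have hsum : ∑ b ∈ B, #(N' b) = t * #S := by
      rw [← sum_degree_eq fun b _ => hN'S b, sum_congr rfl hN't, sum_const, smul_eq_mul, mul_comm]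
    by_cases hS : #A ≤ 6 * #S
    · refine HasBalancedSub.mono (hasBalancedSub_of_constant_degree (A := S) (t := t) hr (by omega)
        hB (fun b _ => hN'S b) (fun b _ => hN'r b) hN't ?_) subset_rfl fun b _ => hN'N b
      have h1 : (t + 1) * #A ≤ (t + 1) * (6 * #S) := Nat.mul_le_mul_left _ hS
      have h2 : #S ≤ t * #S := Nat.le_mul_of_pos_left _ (by omega)
      nlinarith
    · push Not at hS
      set sat := {b ∈ B | r ≤ #(N' b)}
      set bad := {b ∈ B | #(N' b) < r ∧ 12 * r ≤ #(N b \ S)}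
      set B' := {b ∈ B | #(N' b) < r ∧ #(N b \ S) < 12 * r}
      have hcover : #B ≤ #sat + #bad + #B' := by
        refine (card_le_card (t := sat ∪ bad ∪ B') fun b hb => ?_).trans
          ((card_union_le _ _).trans (Nat.add_le_add_right (card_union_le _ _) _))
        simp only [sat, bad, B', mem_union, mem_filter, hb, true_and]
        omega
      have hsat : 3 * #sat ≤ #B := by
        have h1 : #sat * r ≤ ∑ b ∈ sat, #(N' b) :=
          card_nsmul_le_sum _ _ _ fun b hb => (mem_filter.1 hb).2
        have h2 : ∑ b ∈ sat, #(N' b) ≤ t * #S :=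
          hsum ▸ sum_le_sum_of_subset (filter_subset _ _)
        have h3 : t * (6 * #S) ≤ t * #A := Nat.mul_le_mul_left _ hS.le
        have h4 : r * (3 * #sat) ≤ r * #B := by nlinarith
        exact Nat.le_of_mul_le_mul_left h4 (by omega)
      have hbad : 6 * #bad ≤ #B := by
        have h1 : #bad * (12 * r) ≤ ∑ b ∈ bad, #(N b \ S) :=
          card_nsmul_le_sum _ _ _ fun b hb => (mem_filter.1 hb).2.2
        have h2 : ∑ a ∈ A \ S, #{b ∈ bad | a ∈ N b \ S} ≤ #(A \ S) * t := by
          refine sum_le_card_nsmul _ _ _ fun a ha => ?_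
          refine le_trans (card_le_card fun b hb => ?_) (hmax a ha).le
          simp only [bad, mem_filter, mem_sdiff] at hb ⊢
          exact ⟨hb.1.1, hb.2.1, hb.1.2.1⟩
        rw [sum_degree_eq (N := fun b => N b \ S) fun b hb =>
          sdiff_subset_sdiff (hNA b (mem_filter.1 hb).1) subset_rfl] at h2
        have h2' : ∑ b ∈ bad, #(N b \ S) ≤ #(A \ S) * t := h2
        have h3 : #(A \ S) * t ≤ #A * t := Nat.mul_le_mul_right _ (card_le_card sdiff_subset)
        have h4 : (2 * r) * (6 * #bad) ≤ (2 * r) * #B := by nlinarith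
        exact Nat.le_of_mul_le_mul_left h4 (by omega)
      have hB' : #B ≤ 2 * #B' := by omega
      have hB'B : B' ⊆ B := filter_subset _ _
      have hBpos := hB.card_pos
      refine HasBalancedSub.mono (ih S B' (fun b => N b ∩ S) (card_pos.1 (by omega))
        (fun b _ => inter_subset_right) ?_ ?_ ?_ (by omega)) hB'B fun b _ => inter_subset_left
      · intro b hb
        have h1 := hd b (hB'B hb)
        have h2 := (mem_filter.1 hb).2.2
        have h3 := card_inter_add_card_sdiff (N b) S
        have h4 : 12 * r * (j + 1) = 12 * r * j + 12 * r := by ring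
        omega
      · intro a ha
        refine le_trans (card_le_card fun b hb => ?_) (hΔ a (hSA ha))
        simp only [mem_filter, mem_inter] at hb ⊢
        exact ⟨hB'B hb.1, hb.2.1⟩
      · have h1 : Δ * (6 * #S) ≤ Δ * #A := Nat.mul_le_mul_left _ hS.le
        have h2 : 2 ^ j * #B ≤ 2 ^ j * (2 * #B') := Nat.mul_le_mul_left _ hB'
        rw [pow_succ] at hlt
        nlinarith

omit [DecidableEq β] in
/-- If no `r` elements have `r` common neighbours, few `b` have `r` neighbours in `C`. -/
lemma card_filter_le_of_no_biclique {B : Finset β} {N : β → Finset α} {r : ℕ}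
    (hK : ∀ S : Finset α, #S = r → #{b ∈ B | S ⊆ N b} < r) (C : Finset α) :
    #{b ∈ B | r ≤ #(N b ∩ C)} ≤ r * #C ^ r := by
  have hch : ∀ b, ∃ S : Finset α, r ≤ #(N b ∩ C) → S ⊆ N b ∩ C ∧ #S = r := by
    intro b
    by_cases h : r ≤ #(N b ∩ C)
    · obtain ⟨S, hS⟩ := exists_subset_card_eq h
      exact ⟨S, fun _ => hS⟩
    · exact ⟨∅, fun h' => absurd h' h⟩
  choose f hf using hch
  have h1 := card_le_mul_card_image_of_maps_to (s := {b ∈ B | r ≤ #(N b ∩ C)})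
    (t := C.powersetCard r) (f := f) (n := r)
    (fun b hb => mem_powersetCard.2 ⟨(hf b (mem_filter.1 hb).2).1.trans inter_subset_right,
      (hf b (mem_filter.1 hb).2).2⟩) (fun S hS => by
      refine le_trans (card_le_card fun b hb => ?_) (hK S (mem_powersetCard.1 hS).2).le
      simp only [mem_filter] at hb ⊢
      obtain ⟨⟨hbB, hbr⟩, rfl⟩ := hb
      exact ⟨hbB, (hf b hbr).1.trans inter_subset_left⟩)
  refine h1.trans (Nat.mul_le_mul_left _ ?_)
  rw [card_powersetCard]
  exact Nat.choose_le_pow _ _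

omit [DecidableEq β] in
/-- If no `r` elements have `r` common neighbours, few elements have codegree at least `θ`
with a given one. -/
lemma card_large_codegree_lt {B : Finset β} {N : β → Finset α} {r Λ θ M : ℕ}
    (hK : ∀ S : Finset α, #S = r → #{b ∈ B | S ⊆ N b} < r) (hΛ : 2 * r * Λ ≤ M * θ)
    (hθ : 2 * r * M ^ r < θ) (hM : 0 < M) {a : α} (ha : #{b ∈ B | a ∈ N b} ≤ Λ)
    {C : Finset α} (hC : ∀ a' ∈ C, θ ≤ #{b ∈ B | a ∈ N b ∧ a' ∈ N b}) : #C < M := by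
  by_contra! hcon
  obtain ⟨C', hC'C, hC'⟩ := exists_subset_card_eq hcon
  set Ba := {b ∈ B | a ∈ N b}
  have h1 : M * θ ≤ ∑ b ∈ Ba, #(N b ∩ C') := by
    rw [← sum_degree_eq (A := C') (N := fun b => N b ∩ C') fun b _ => inter_subset_right, ← hC']
    refine card_nsmul_le_sum _ _ _ fun a' ha' => (hC a' (hC'C ha')).trans (card_le_card ?_)
    intro b hb
    simp only [Ba, mem_filter, mem_inter] at hb ⊢
    exact ⟨⟨hb.1, hb.2.1⟩, hb.2.2, ha'⟩
  have h2 : ∑ b ∈ Ba, #(N b ∩ C') ≤ ∑ b ∈ Ba, (r + if r ≤ #(N b ∩ C') then M else 0) := by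
    refine sum_le_sum fun b _ => ?_
    split_ifs with h
    · have := card_le_card (inter_subset_right : N b ∩ C' ⊆ C')
      omega
    · omega
  have h3 : #{b ∈ Ba | r ≤ #(N b ∩ C')} ≤ r * M ^ r := by
    refine le_trans (card_le_card (filter_subset_filter _ (filter_subset _ _))) ?_
    rw [← hC']
    exact card_filter_le_of_no_biclique hK C'
  have h4 : ∑ b ∈ Ba, (r + if r ≤ #(N b ∩ C') then M else 0)
      = #Ba * r + #{b ∈ Ba | r ≤ #(N b ∩ C')} * M := by
    rw [sum_add_distrib, sum_const, smul_eq_mul, ← sum_filter, sum_const, smul_eq_mul]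
  have h5 : #Ba * r ≤ Λ * r := Nat.mul_le_mul_right _ ha
  have h6 := Nat.mul_le_mul_right M h3
  have h7 : M * (2 * r * M ^ r) < M * θ := Nat.mul_lt_mul_of_pos_left hθ hM
  nlinarith

/-- Greedy independent set. -/
lemma exists_independent_subset {c : α → α → Prop} (hc : ∀ a b, c a b → c b a)
    [DecidableRel c] {r : ℕ} (hr : 0 < r) (m : ℕ) :
    ∀ T : Finset α, (∀ a ∈ T, #{x ∈ T | c a x} < r) → r * m ≤ #T →
      ∃ I ⊆ T, #I = m ∧ ∀ a ∈ I, ∀ b ∈ I, a ≠ b → ¬ c a b := by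
  induction m with
  | zero => exact fun T _ _ => ⟨∅, by simp⟩
  | succ m ih =>
    intro T hT hcard
    have hTne : T.Nonempty := by
      rw [nonempty_iff_ne_empty]
      rintro rfl
      simp only [card_empty, nonpos_iff_eq_zero, mul_eq_zero] at hcard
      omega
    obtain ⟨a, ha⟩ := hTne
    have hlt := hT a ha
    set T' := {x ∈ T.erase a | ¬ c a x} with hT'
    have hT'T : T' ⊆ T := (filter_subset _ _).trans (erase_subset _ _)
    have hT'card : r * m ≤ #T' := by
      have h1 := card_filter_add_card_filter_not (s := T.erase a) (fun x => c a x)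
      have h2 : #{x ∈ T.erase a | c a x} ≤ #{x ∈ T | c a x} :=
        card_le_card (filter_subset_filter _ (erase_subset _ _))
      rw [card_erase_of_mem ha] at h1
      rw [mul_add, mul_one] at hcard
      rw [hT']
      omega
    obtain ⟨I, hI, hIm, hIc⟩ := ih T' (fun x hx => lt_of_le_of_lt
      (card_le_card (filter_subset_filter _ hT'T)) (hT x (hT'T hx))) hT'card
    have haI : a ∉ I := fun h => by
      have := hI h
      simp [hT'] at this
    refine ⟨insert a I, insert_subset ha (hI.trans hT'T),
      by rw [card_insert_of_notMem haI, hIm], ?_⟩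
    intro x hx y hy hxy
    rcases mem_insert.1 hx with hx | hx <;> rcases mem_insert.1 hy with hy | hy
    · exact absurd (hx.trans hy.symm) hxy
    · exact hx ▸ (mem_filter.1 (hI hy)).2
    · exact fun h => (mem_filter.1 (hI hx)).2 (hc _ _ (hy ▸ h))
    · exact hIc x hx y hy hxy

/-- Passing to `r`-element neighbourhoods whose elements have pairwise codegree below `θ`. -/
lemma exists_small_codegree_sub {A : Finset α} {B : Finset β} {N : β → Finset α}
    {r Λ θ M : ℕ} (hr : 0 < r) (hK : ∀ S : Finset α, #S = r → #{b ∈ B | S ⊆ N b} < r)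
    (hNA : ∀ b ∈ B, N b ⊆ A) (hN : ∀ b ∈ B, #(N b) = 2 * r ^ 2)
    (hdeg : ∀ a ∈ A, #{b ∈ B | a ∈ N b} ≤ Λ) (hΛ : 2 * r * Λ ≤ M * θ)
    (hθ : 2 * r * M ^ r < θ) (hM : 0 < M) (hA : #A * θ ≤ r ^ 2 * #B) :
    ∃ B' ⊆ B, ∃ N' : β → Finset α, #B ≤ 2 * #B' ∧ ∀ b ∈ B', N' b ⊆ N b ∧ #(N' b) = r ∧
      ∀ a ∈ N' b, ∀ a' ∈ N' b, a ≠ a' → #{b' ∈ B | a ∈ N b' ∧ a' ∈ N b'} < θ := by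
  set C : α → Finset α := fun a => {a' ∈ A | θ ≤ #{b ∈ B | a ∈ N b ∧ a' ∈ N b}} with hCdef
  have hC : ∀ a ∈ A, #(C a) < M := fun a ha =>
    card_large_codegree_lt hK hΛ hθ hM (hdeg a ha) fun a' ha' => (mem_filter.1 ha').2
  set G : β → Finset α := fun b => {a ∈ N b | #(N b ∩ C a) < r} with hGdef
  set B' := {b ∈ B | r ^ 2 ≤ #(G b)} with hB'def
  have hbad : 2 * #(B \ B') ≤ #B := by
    have h1 : #(B \ B') * r ^ 2 ≤ ∑ b ∈ B \ B', #(N b \ G b) := by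
      refine card_nsmul_le_sum _ _ _ fun b hb => ?_
      obtain ⟨hbB, hb'⟩ := mem_sdiff.1 hb
      have h2 : #(G b) < r ^ 2 := by
        by_contra! h; exact hb' (mem_filter.2 ⟨hbB, h⟩)
      have h3 := card_sdiff_add_card_eq_card (filter_subset (fun a => #(N b ∩ C a) < r) (N b))
      have h4 := hN b hbB
      simp only [hGdef] at h2 ⊢
      omega
    have h2 : ∑ b ∈ B \ B', #(N b \ G b) ≤ #A * (r * M ^ r) := by
      rw [← sum_degree_eq (A := A) (N := fun b => N b \ G b) fun b hb =>
        sdiff_subset.trans (hNA b (mem_sdiff.1 hb).1)]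
      refine sum_le_card_nsmul _ _ _ fun a ha => ?_
      refine (card_le_card (t := {b ∈ B | r ≤ #(N b ∩ C a)}) fun b hb => ?_).trans
        ((card_filter_le_of_no_biclique hK (C a)).trans
          (Nat.mul_le_mul_left _ (Nat.pow_le_pow_left (hC a ha).le _)))
      simp only [hGdef, mem_filter, mem_sdiff, not_and, not_lt] at hb ⊢
      exact ⟨hb.1.1, hb.2.2 hb.2.1⟩
    have h3 : #A * (2 * r * M ^ r) ≤ #A * θ := Nat.mul_le_mul_left _ hθ.le
    have h4 : r ^ 2 * (2 * #(B \ B')) ≤ r ^ 2 * #B := by nlinarith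
    exact Nat.le_of_mul_le_mul_left h4 (by positivity)
  have hind : ∀ b, ∃ I : Finset α, b ∈ B' → I ⊆ N b ∧ #I = r ∧
      ∀ a ∈ I, ∀ a' ∈ I, a ≠ a' → #{b' ∈ B | a ∈ N b' ∧ a' ∈ N b'} < θ := by
    intro b
    by_cases hb : b ∈ B'
    · obtain ⟨hbB, hbr⟩ := mem_filter.1 hb
      obtain ⟨I, hI, hIr, hIc⟩ := exists_independent_subset
        (c := fun a a' => θ ≤ #{b ∈ B | a ∈ N b ∧ a' ∈ N b}) (fun a a' h => by
          simpa only [and_comm] using h) (r := r) hr r (G b) (fun a ha => by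
          refine lt_of_le_of_lt (card_le_card fun x hx => ?_) (mem_filter.1 ha).2
          have hxN := (mem_filter.1 (mem_filter.1 hx).1).1
          exact mem_inter.2 ⟨hxN, mem_filter.2 ⟨hNA b hbB hxN, (mem_filter.1 hx).2⟩⟩)
        (by rw [← sq]; exact hbr)
      exact ⟨I, fun _ => ⟨hI.trans (filter_subset _ _), hIr,
        fun a ha a' ha' h => not_le.1 (hIc a ha a' ha' h)⟩⟩
    · exact ⟨∅, fun h => absurd h hb⟩
  choose N' hN' using hind
  refine ⟨B', filter_subset _ _, N', ?_, hN'⟩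
  have := card_sdiff_add_card_eq_card (filter_subset (fun b => r ^ 2 ≤ #(G b)) B)
  simp only [hB'def] at hbad ⊢
  omega

/-- Removing vertices of small degree. -/
lemma exists_min_degree_sub {A : Finset α} {B : Finset β} {N : β → Finset α}
    {r D : ℕ} (hr : 0 < r) (hB : B.Nonempty) (hNA : ∀ b ∈ B, N b ⊆ A) (hN : ∀ b ∈ B, #(N b) = r)
    (hD : 2 * (D * #A) ≤ r * #B) :
    ∃ A' ⊆ A, ∃ B' ⊆ B, B'.Nonempty ∧ (∀ a ∈ A', D ≤ #{b ∈ B' | a ∈ N b}) ∧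
      ∀ b ∈ B', r ≤ 4 * #(N b ∩ A') := by
  set F : Finset (Finset α × Finset β) := {x ∈ A.powerset ×ˢ B.powerset |
    r * #x.2 + 4 * D * #x.1 < 4 * ∑ b ∈ x.2, #(N b ∩ x.1)} with hF
  have hne : F.Nonempty := by
    refine ⟨(A, B), mem_filter.2 ⟨by simp, ?_⟩⟩
    have h1 : ∑ b ∈ B, #(N b ∩ A) = #B * r := by
      rw [sum_congr rfl fun b hb => by rw [inter_eq_left.2 (hNA b hb), hN b hb], sum_const,
        smul_eq_mul]
    have h2 : 0 < r * #B := Nat.mul_pos hr hB.card_pos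
    dsimp only
    rw [h1]
    nlinarith
  obtain ⟨⟨A', B'⟩, hx, hmin⟩ := exists_min_image F (fun x => #x.1 + #x.2) hne
  obtain ⟨hx1, hx2⟩ := mem_filter.1 hx
  obtain ⟨hA', hB'⟩ := mem_product.1 hx1
  simp only [mem_powerset] at hA' hB' hx2
  refine ⟨A', hA', B', hB', ?_, fun a ha => ?_, fun b hb => ?_⟩
  · rw [nonempty_iff_ne_empty]
    rintro rfl
    simp at hx2
  · by_contra! hcon
    have hmem : (A'.erase a, B') ∈ F := by
      refine mem_filter.2 ⟨by simpa using ⟨(erase_subset _ _).trans hA', hB'⟩, ?_⟩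
      dsimp only
      have h1 : ∑ b ∈ B', #(N b ∩ A') = ∑ b ∈ B', #(N b ∩ A'.erase a) + #{b ∈ B' | a ∈ N b} := by
        rw [card_filter, ← sum_add_distrib]
        refine sum_congr rfl fun b _ => ?_
        rw [inter_erase]
        split_ifs with h
        · rw [card_erase_add_one (mem_inter.2 ⟨h, ha⟩)]
        · rw [erase_eq_of_notMem fun h' => h (mem_inter.1 h').1, add_zero]
      rw [h1] at hx2
      rw [← card_erase_add_one ha] at hx2
      nlinarith
    have h2 := hmin _ hmem
    have h3 := card_erase_add_one ha
    dsimp only at h2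
    omega
  · by_contra! hcon
    have hmem : (A', B'.erase b) ∈ F := by
      refine mem_filter.2 ⟨by simpa using ⟨hA', (erase_subset _ _).trans hB'⟩, ?_⟩
      dsimp only
      rw [← sum_erase_add _ _ hb, ← card_erase_add_one hb] at hx2
      nlinarith
    have h2 := hmin _ hmem
    have h3 := card_erase_add_one hb
    dsimp only at h2
    omega

/-- The sampling lemma when the degrees on the `A` side are within a factor `L` of each other
and elements with a common neighbour have small codegree. -/
lemma hasBalancedSub_of_codegree_le {A : Finset α} {B : Finset β} {N : β → Finset α}
    {r D L θ : ℕ} (hr : 8 ≤ r) (hB : B.Nonempty) (hNA : ∀ b ∈ B, N b ⊆ A)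
    (hNr : ∀ b ∈ B, #(N b) ≤ r) (he : r * #B ≤ 4 * ∑ b ∈ B, #(N b)) (hD : 0 < D) (hL : 0 < L)
    (hdeg : ∀ a ∈ A, D ≤ #{b ∈ B | a ∈ N b} ∧ #{b ∈ B | a ∈ N b} ≤ L * D)
    (hco : ∀ b ∈ B, ∀ a ∈ N b, ∀ a' ∈ N b, a ≠ a' → #{b' ∈ B | a ∈ N b' ∧ a' ∈ N b'} ≤ θ)
    (hθ : r * θ * L ^ r ≤ D) (hrL : r * L ^ r ≤ 8 * (L * D)) : HasBalancedSub N B r := by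
  have hr' : (8 : ℝ) ≤ r := by exact_mod_cast hr
  have hD' : (0 : ℝ) < D := by exact_mod_cast hD
  have hL' : (0 : ℝ) < L := by exact_mod_cast hL
  have hL1 : (1 : ℝ) ≤ L := by exact_mod_cast hL
  have hθ' : (r : ℝ) * θ * L ^ r ≤ D := by exact_mod_cast hθ
  have hrL' : (r : ℝ) * L ^ r ≤ 8 * (L * D) := by exact_mod_cast hrL
  set p : α → ℝ := fun a => #{b ∈ B | a ∈ N b} / (L * D) with hp
  set ρ : ℝ := r / (8 * (L * D)) with hρ
  have hρ0 : 0 < ρ := by positivity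
  have hpL : ∀ a ∈ A, (L : ℝ)⁻¹ ≤ p a ∧ p a ≤ 1 := by
    intro a ha
    have h1 : (D : ℝ) ≤ #{b ∈ B | a ∈ N b} := by exact_mod_cast (hdeg a ha).1
    have h2 : (#{b ∈ B | a ∈ N b} : ℝ) ≤ L * D := by exact_mod_cast (hdeg a ha).2
    refine ⟨?_, (div_le_one (by positivity)).2 h2⟩
    rw [hp, le_div_iff₀ (by positivity)]
    calc (L : ℝ)⁻¹ * (L * D) = D := by field_simp
      _ ≤ _ := h1
  have hp0 : ∀ a ∈ A, 0 < p a := fun a ha => lt_of_lt_of_le (by positivity) (hpL a ha).1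
  have hprod : ∀ b ∈ B, ∀ S ⊆ N b, ((L : ℝ) ^ r)⁻¹ ≤ ∏ x ∈ S, p x := by
    intro b hb S hS
    have h1 : ∏ _x ∈ S, (L : ℝ)⁻¹ ≤ ∏ x ∈ S, p x :=
      prod_le_prod (fun _ _ => by positivity) fun x hx => (hpL x (hNA b hb (hS hx))).1
    rw [prod_const, inv_pow] at h1
    refine le_trans (inv_anti₀ (by positivity) (pow_le_pow_right₀ hL1 ?_)) h1
    exact (card_le_card hS).trans (hNr b hb)
  have hprod0 : ∀ b ∈ B, ∀ S ⊆ N b, 0 < ∏ x ∈ S, p x := fun b hb S hS =>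
    lt_of_lt_of_le (by positivity) (hprod b hb S hS)
  have hρL : ρ * L ^ r ≤ 1 := by
    rw [hρ, div_mul_eq_mul_div, div_le_one (by positivity)]; exact hrL'
  have hρt : ∀ a, 8 * (ρ * #{b ∈ B | a ∈ N b}) = r * p a := by
    intro a; simp only [hρ, hp]; field_simp
  refine hasBalancedSub_of_sampling (p := p) (q := fun b => ρ / ∏ x ∈ N b, p x) (ρ := ρ)
    (by omega) hρ0 hB hNA hNr he (fun a ha => ⟨hp0 a ha, (hpL a ha).2⟩) ?_ ?_
    (fun a _ => hρt a) ?_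
  · intro b hb
    have h0 := hprod0 b hb _ subset_rfl
    refine ⟨div_nonneg hρ0.le h0.le, (div_le_one h0).2 (le_trans ?_ (hprod b hb _ subset_rfl))⟩
    rw [← one_div, le_div_iff₀ (by positivity)]
    exact hρL
  · intro b hb
    exact mul_div_cancel₀ _ (hprod0 b hb _ subset_rfl).ne'
  · intro a ha
    have hpa := hp0 a ha
    set T := {b ∈ B | a ∈ N b} with hT
    have hin : ∀ b ∈ T, ∑ b' ∈ T, (if b = b' then ρ else ρ ^ 2 / ∏ x ∈ N b ∩ N b', p x)
        ≤ ρ + #T * (ρ ^ 2 / p a) + D * ρ ^ 2 := by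
      intro b hb
      obtain ⟨hbB, hab⟩ := mem_filter.1 hb
      have hcount : #{b' ∈ T | N b ∩ N b' ≠ {a}} ≤ r * θ := by
        refine (card_le_card (t := (N b \ {a}).biUnion
          fun a' => {b' ∈ B | a ∈ N b' ∧ a' ∈ N b'}) fun b' hb' => ?_).trans
          ((card_biUnion_le_card_mul _ _ θ fun a' ha' => ?_).trans
            (Nat.mul_le_mul_right _ ((card_le_card sdiff_subset).trans (hNr b hbB))))
        · obtain ⟨hb'T, hne⟩ := mem_filter.1 hb'
          obtain ⟨hb'B, hab'⟩ := mem_filter.1 hb'T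
          obtain ⟨x, hx, hxa⟩ : ∃ x ∈ N b ∩ N b', x ≠ a := by
            by_contra! h
            exact hne (eq_singleton_iff_unique_mem.2 ⟨mem_inter.2 ⟨hab, hab'⟩, h⟩)
          rw [mem_inter] at hx
          exact mem_biUnion.2 ⟨x, by simp [hx.1, hxa], by simp [hb'B, hab', hx.2]⟩
        · rw [mem_sdiff, mem_singleton] at ha'
          exact hco b hbB a hab a' ha'.1 (Ne.symm ha'.2)
      have hcount' : (#{b' ∈ T | N b ∩ N b' ≠ {a}} : ℝ) ≤ r * θ := by exact_mod_cast hcount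
      calc ∑ b' ∈ T, (if b = b' then ρ else ρ ^ 2 / ∏ x ∈ N b ∩ N b', p x)
          ≤ ∑ b' ∈ T, ((if b = b' then ρ else 0) + ρ ^ 2 / p a
              + if N b ∩ N b' ≠ {a} then ρ ^ 2 * L ^ r else 0) := by
            refine sum_le_sum fun b' _ => ?_
            have h1 : 0 < ρ ^ 2 / p a := by positivity
            have h2 : 0 < ρ ^ 2 * (L : ℝ) ^ r := by positivity
            by_cases hbb : b = b'
            · rw [if_pos hbb, if_pos hbb]
              split_ifs <;> linarith
            · rw [if_neg hbb, if_neg hbb, zero_add]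
              by_cases hs : N b ∩ N b' = {a}
              · simp [hs]
              · rw [if_pos hs]
                have h3 := hprod b hbB (N b ∩ N b') inter_subset_left
                have h4 : ρ ^ 2 / ∏ x ∈ N b ∩ N b', p x ≤ ρ ^ 2 / ((L : ℝ) ^ r)⁻¹ :=
                  div_le_div_of_nonneg_left (by positivity) (by positivity) h3
                rw [div_inv_eq_mul] at h4
                linarith
        _ = ρ + #T * (ρ ^ 2 / p a) + #{b' ∈ T | N b ∩ N b' ≠ {a}} * (ρ ^ 2 * L ^ r) := by
            rw [sum_add_distrib, sum_add_distrib, sum_ite_eq, if_pos hb, sum_const, nsmul_eq_mul,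
              ← sum_filter, sum_const, nsmul_eq_mul]
        _ ≤ ρ + #T * (ρ ^ 2 / p a) + D * ρ ^ 2 := by
            have h1 := mul_le_mul_of_nonneg_right hcount'
              (by positivity : 0 ≤ ρ ^ 2 * (L : ℝ) ^ r)
            have h2 := mul_le_mul_of_nonneg_right hθ' (by positivity : 0 ≤ ρ ^ 2)
            linarith
    have h1 := sum_le_sum hin
    rw [sum_const, nsmul_eq_mul] at h1
    have ht := hρt a
    rw [← hT] at ht
    have hDT : (D : ℝ) ≤ #T := by exact_mod_cast (hdeg a ha).1
    have e1 : 64 * ((#T : ℝ) * ρ) = 8 * r * p a := by linarith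
    have e2 : 64 * ((#T : ℝ) * (#T * (ρ ^ 2 / p a))) = r ^ 2 * p a := by
      have : 64 * ((#T : ℝ) * (#T * (ρ ^ 2 / p a))) = (8 * (ρ * #T)) ^ 2 / p a := by ring
      rw [this, ht]
      field_simp
    have e3 : 64 * ((#T : ℝ) * (D * ρ ^ 2)) ≤ r ^ 2 * p a := by
      have h3 : 64 * ((#T : ℝ) * (D * ρ ^ 2)) = (8 * (ρ * #T)) * (8 * (ρ * D)) := by ring
      have h4 : 8 * (ρ * D) ≤ 8 * (ρ * #T) := by
        have := mul_le_mul_of_nonneg_left hDT hρ0.le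
        linarith
      have h5 : (r : ℝ) * p a ≤ r := mul_le_of_le_one_right (by linarith) (hpL a ha).2
      rw [h3, ht]
      rw [ht] at h4
      have := mul_le_mul_of_nonneg_left (h4.trans h5) (by positivity : 0 ≤ (r : ℝ) * p a)
      linarith
    have e4 : 8 * (r : ℝ) * p a ≤ r ^ 2 * p a :=
      mul_le_mul_of_nonneg_right (by nlinarith) hpa.le
    linarith

/-- If the degrees on the `A` side are at most `L * D`, where `D` is a lower bound for the
average degree up to constants, and there is no biclique, it suffices that `L` is small. -/
lemma hasBalancedSub_of_no_biclique {A : Finset α} {B : Finset β} {N : β → Finset α}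
    {r D L θ M : ℕ} (hr : 8 ≤ r) (hB : B.Nonempty)
    (hK : ∀ S : Finset α, #S = r → #{b ∈ B | S ⊆ N b} < r)
    (hNA : ∀ b ∈ B, N b ⊆ A) (hN : ∀ b ∈ B, #(N b) = 2 * r ^ 2)
    (hdeg : ∀ a ∈ A, #{b ∈ B | a ∈ N b} ≤ L * D) (hL : 0 < L)
    (hΛ : 2 * r * (L * D) ≤ M * θ) (hθ : 2 * r * M ^ r < θ) (hM : 0 < M)
    (hD : r * θ * L ^ r ≤ D) (hA : 4 * (D * #A) ≤ r * #B) : HasBalancedSub N B r := by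
  have hLr : 0 < L ^ r := by positivity
  have hθ0 : 0 < θ := by omega
  have h1 : θ ≤ r * θ * L ^ r := by
    calc θ = 1 * θ * 1 := by ring
      _ ≤ r * θ * L ^ r := by gcongr <;> omega
  have hA' : #A * θ ≤ r ^ 2 * #B := by
    have h2 : θ * #A ≤ D * #A := Nat.mul_le_mul_right _ (h1.trans hD)
    have h3 : 1 * (r * #B) ≤ r * (r * #B) := Nat.mul_le_mul_right _ (by omega)
    nlinarith
  obtain ⟨B₂, hB₂, N₂, hcard, hN₂⟩ :=
    exists_small_codegree_sub (by omega) hK hNA hN hdeg hΛ hθ hM hA'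
  have hB₂ne : B₂.Nonempty := card_pos.1 (by have := hB.card_pos; omega)
  obtain ⟨A₃, hA₃, B₃, hB₃, hB₃ne, hmin, hNb⟩ := exists_min_degree_sub (A := A) (D := D)
    (by omega) hB₂ne (fun b hb => (hN₂ b hb).1.trans (hNA b (hB₂ hb))) (fun b hb => (hN₂ b hb).2.1)
    (by nlinarith)
  have hN₃ : ∀ b ∈ B₃, N₂ b ∩ A₃ ⊆ N b := fun b hb =>
    inter_subset_left.trans (hN₂ b (hB₃ hb)).1
  refine (hasBalancedSub_of_codegree_le (A := A₃) (B := B₃) (N := fun b => N₂ b ∩ A₃) (D := D)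
    (L := L) (θ := θ) hr hB₃ne (fun b _ => inter_subset_right) (fun b hb => ?_) ?_ (by omega) hL
    (fun a ha => ⟨?_, ?_⟩) ?_ hD ?_).mono (hB₃.trans hB₂) hN₃
  · exact (card_le_card inter_subset_left).trans (hN₂ b (hB₃ hb)).2.1.le
  · rw [mul_sum, mul_comm]
    exact card_nsmul_le_sum _ _ _ hNb
  · refine (hmin a ha).trans (card_le_card fun b hb => ?_)
    rw [mem_filter] at hb ⊢
    exact ⟨hb.1, mem_inter.2 ⟨hb.2, ha⟩⟩
  · refine le_trans (card_le_card fun b hb => ?_) (hdeg a (hA₃ ha))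
    rw [mem_filter] at hb ⊢
    exact ⟨hB₂ (hB₃ hb.1), hN₃ b hb.1 hb.2⟩
  · intro b hb a ha a' ha' hne
    refine le_trans (card_le_card fun x hx => ?_)
      ((hN₂ b (hB₃ hb)).2.2 a (mem_inter.1 ha).1 a' (mem_inter.1 ha').1 hne).le
    rw [mem_filter] at hx ⊢
    exact ⟨hB₂ (hB₃ hx.1), hN₃ x hx.1 hx.2.1, hN₃ x hx.1 hx.2.2⟩
  · have h4 : r * L ^ r ≤ r * θ * L ^ r := by
      gcongr
      exact Nat.le_mul_of_pos_right _ hθ0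
    have h5 : 1 * D ≤ L * D := Nat.mul_le_mul_right _ hL
    omega

/-- `hasBalancedSub_of_no_biclique` with parameters that are powers of two. -/
lemma hasBalancedSub_of_dyadic {A : Finset α} {B : Finset β} {N : β → Finset α}
    {r κ τ δ : ℕ} (hr : 8 ≤ r) (hB : B.Nonempty)
    (hK : ∀ S : Finset α, #S = r → #{b ∈ B | S ⊆ N b} < r)
    (hNA : ∀ b ∈ B, N b ⊆ A) (hN : ∀ b ∈ B, #(N b) = 2 * r ^ 2)
    (hdeg : ∀ a ∈ A, #{b ∈ B | a ∈ N b} ≤ 2 ^ (τ + δ)) (hτ : 16 * r ^ 2 * δ ≤ τ)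
    (hκδ : κ ≤ δ) (hκ : 0 < κ) (hrκ : r ≤ 2 ^ κ) (hA : 4 * (2 ^ τ * #A) ≤ 2 ^ κ * #B) :
    HasBalancedSub N B r := by
  have hrδ : 64 * δ ≤ r * r * δ := Nat.mul_le_mul_right _ (by nlinarith)
  have hrδ' : 8 * (r * δ) ≤ r * (r * δ) := Nat.mul_le_mul_right _ hr
  have hrκ' : r * κ ≤ r * δ := Nat.mul_le_mul_left _ hκδ
  have hrrκ : r * (r * κ) ≤ r * (r * δ) := Nat.mul_le_mul_left _ hrκ'
  have hrr : r * 1 ≤ r * δ := Nat.mul_le_mul_left _ (by omega)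
  obtain ⟨e, he⟩ : ∃ e, τ = e + (2 * κ + r * (δ + κ)) :=
    Nat.exists_eq_add_of_le' (by nlinarith)
  have hexp : 1 + κ + r * (1 + 3 * κ + δ + r * (δ + κ)) < e := by nlinarith
  refine hasBalancedSub_of_no_biclique (D := 2 ^ (e + κ + r * (δ + κ))) (L := 2 ^ (δ + κ))
    (θ := 2 ^ e) (M := 2 ^ (1 + 3 * κ + δ + r * (δ + κ))) hr hB hK hNA hN ?_ (by positivity)
    ?_ ?_ (by positivity) ?_ ?_
  · intro a ha
    rw [← pow_add]
    convert hdeg a ha using 2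
    rw [he]; ring
  · calc 2 * r * (2 ^ (δ + κ) * 2 ^ (e + κ + r * (δ + κ)))
        ≤ 2 * 2 ^ κ * (2 ^ (δ + κ) * 2 ^ (e + κ + r * (δ + κ))) := by gcongr
      _ = _ := by ring
  · calc 2 * r * (2 ^ (1 + 3 * κ + δ + r * (δ + κ))) ^ r
        ≤ 2 * 2 ^ κ * (2 ^ (1 + 3 * κ + δ + r * (δ + κ))) ^ r := by gcongr
      _ = 2 ^ (1 + κ + r * (1 + 3 * κ + δ + r * (δ + κ))) := by
          rw [← pow_mul, pow_add, pow_add, pow_one, mul_comm _ r]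
      _ < 2 ^ e := Nat.pow_lt_pow_right (by norm_num) hexp
  · calc r * 2 ^ e * (2 ^ (δ + κ)) ^ r ≤ 2 ^ κ * 2 ^ e * (2 ^ (δ + κ)) ^ r := by gcongr
      _ = 2 ^ (e + κ + r * (δ + κ)) := by rw [← pow_mul, mul_comm r]; ring
  · have h1 : 2 ^ κ * (4 * (2 ^ (e + κ + r * (δ + κ)) * #A)) ≤ 2 ^ κ * #B := by
      refine le_of_eq_of_le ?_ hA
      rw [he]; ring
    have h2 := Nat.le_of_mul_le_mul_left h1 (by positivity)
    exact h2.trans (Nat.le_mul_of_pos_left _ (by omega))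

lemma exists_growth_sequence {K κ : ℕ} (hK : 0 < K) (hκ : 0 < κ) (ℓ : ℕ) :
    ∃ τ δ : ℕ → ℕ, τ 0 = K * κ ∧ (∀ i, τ (i + 1) = τ i + δ i) ∧ (∀ i, K * δ i ≤ τ i) ∧
      (∀ i, κ ≤ δ i) ∧ 2 ^ ℓ ≤ τ (2 * K * ℓ) := by
  set τ : ℕ → ℕ := fun i => (fun t => t + t / K)^[i] (K * κ)
  have hsucc : ∀ i, τ (i + 1) = τ i + τ i / K := fun i => Function.iterate_succ_apply' _ _ _
  have hmono : Monotone τ := monotone_nat_of_le_succ fun i => by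
    rw [hsucc]; exact Nat.le_add_right _ _
  have h0 : ∀ i, K * κ ≤ τ i := fun i => hmono (Nat.zero_le i)
  have hδ : ∀ i, κ ≤ τ i / K := fun i => by
    rw [Nat.le_div_iff_mul_le hK, mul_comm]; exact h0 i
  refine ⟨τ, fun i => τ i / K, rfl, hsucc, fun i => Nat.mul_div_le _ _, hδ, ?_⟩
  have hadd : ∀ i k, τ i + k * (τ i / K) ≤ τ (i + k) := by
    intro i k
    induction k with
    | zero => simp
    | succ k ih =>
      have h1 : τ i / K ≤ τ (i + k) / K := Nat.div_le_div_right (hmono (Nat.le_add_right _ _))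
      rw [← add_assoc, hsucc, add_mul, one_mul]
      omega
  have hdouble : ∀ i, 2 * τ i ≤ τ (i + 2 * K) := by
    intro i
    refine le_trans ?_ (hadd i (2 * K))
    have h1 := Nat.lt_mul_div_succ (τ i) hK
    have h2 : K * 1 ≤ K * (τ i / K) := Nat.mul_le_mul_left _ (hκ.trans_le (hδ i))
    nlinarith
  induction ℓ with
  | zero => exact (Nat.mul_pos hK hκ).trans_le (h0 _)
  | succ ℓ ih =>
    rw [mul_add, mul_one, pow_succ]
    have := hdouble (2 * K * ℓ)
    omega

/-- If every `b` has many neighbours of degree above `2 ^ τ 0`, one of the ranges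
`(2 ^ τ i, 2 ^ τ (i + 1)]` of degrees gives a balanced substructure. -/
lemma hasBalancedSub_of_high_degree {A : Finset α} {B B₀ : Finset β} {N : β → Finset α}
    {r d κ c : ℕ} {τ δ : ℕ → ℕ} (hr : 8 ≤ r) (hB : B.Nonempty) (hBB : B ⊆ B₀)
    (hcard : #B₀ ≤ 2 * #B) (hK : ∀ S : Finset α, #S = r → #{b ∈ B₀ | S ⊆ N b} < r)
    (hNA : ∀ b ∈ B₀, N b ⊆ A) (hN : ∀ b ∈ B₀, #(N b) ≤ d)
    (hhigh : ∀ b ∈ B, c * (2 * r ^ 2) < #{a ∈ N b | 2 ^ τ 0 < #{b ∈ B₀ | a ∈ N b}})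
    (hτ : ∀ i, τ (i + 1) = τ i + δ i) (hδτ : ∀ i, 16 * r ^ 2 * δ i ≤ τ i) (hδ : ∀ i, κ ≤ δ i)
    (hκ : 0 < κ) (hrκ : r ≤ 2 ^ κ) (hcd : 8 * c * d ≤ 2 ^ κ)
    (hdeg : ∀ a ∈ A, #{b ∈ B₀ | a ∈ N b} ≤ 2 ^ τ c) : HasBalancedSub N B₀ r := by
  set deg : α → ℕ := fun a => #{b ∈ B₀ | a ∈ N b} with hdegdef
  have hlev : ∀ k, ∀ a, 2 ^ τ 0 < deg a → deg a ≤ 2 ^ τ k →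
      ∃ i < k, 2 ^ τ i < deg a ∧ deg a ≤ 2 ^ τ (i + 1) := by
    intro k a h0
    induction k with
    | zero => intro h; omega
    | succ k ih =>
      intro h
      by_cases hk : deg a ≤ 2 ^ τ k
      · obtain ⟨i, hi, hi'⟩ := ih hk
        exact ⟨i, by omega, hi'⟩
      · exact ⟨k, by omega, by omega, h⟩
  set Al : ℕ → Finset α := fun i => {a ∈ A | 2 ^ τ i < deg a ∧ deg a ≤ 2 ^ τ (i + 1)} with hAl
  set Bl : ℕ → Finset β := fun i => {b ∈ B | 2 * r ^ 2 ≤ #(N b ∩ Al i)} with hBl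
  have hcover : B ⊆ (range c).biUnion Bl := by
    intro b hb
    by_contra hcon
    have hcon' : ∀ i < c, #(N b ∩ Al i) < 2 * r ^ 2 := by
      intro i hi
      by_contra! h
      exact hcon (mem_biUnion.2 ⟨i, mem_range.2 hi, mem_filter.2 ⟨hb, h⟩⟩)
    have h1 : #{a ∈ N b | 2 ^ τ 0 < deg a} ≤ c * (2 * r ^ 2) := by
      refine (card_le_card (t := (range c).biUnion fun i => N b ∩ Al i) fun a ha => ?_).trans
        ((card_biUnion_le_card_mul _ _ _ fun i hi => (hcon' i (mem_range.1 hi)).le).trans ?_)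
      · obtain ⟨haN, ha0⟩ := mem_filter.1 ha
        have haA := hNA b (hBB hb) haN
        obtain ⟨i, hi, hi'⟩ := hlev c a ha0 (hdeg a haA)
        exact mem_biUnion.2 ⟨i, mem_range.2 hi, mem_inter.2 ⟨haN, mem_filter.2 ⟨haA, hi'⟩⟩⟩
      · rw [card_range]
    exact absurd (hhigh b hb) (not_lt.2 h1)
  obtain ⟨i, hi, hBi⟩ : ∃ i < c, #B ≤ c * #(Bl i) := by
    by_contra! hcon
    have h1 : ∀ i ∈ range c, c * #(Bl i) + 1 ≤ #B := fun i hi => hcon i (mem_range.1 hi)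
    have h2 := sum_le_sum h1
    have h3 := (card_le_card hcover).trans card_biUnion_le
    rw [sum_add_distrib, ← mul_sum, sum_const, sum_const, card_range, smul_eq_mul,
      smul_eq_mul] at h2
    have h4 := Nat.mul_le_mul_left c h3
    have hc : c = 0 := by omega
    subst hc
    simp only [range_zero, biUnion_empty, subset_empty] at hcover
    exact hB.ne_empty hcover
  have hBlne : (Bl i).Nonempty := by
    rw [nonempty_iff_ne_empty]
    intro h
    rw [h, card_empty, mul_zero] at hBi
    exact absurd hB.card_pos (by omega)
  have hBlB : Bl i ⊆ B₀ := (filter_subset _ _).trans hBB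
  have hch : ∀ b, ∃ S : Finset α, b ∈ Bl i → S ⊆ N b ∩ Al i ∧ #S = 2 * r ^ 2 := by
    intro b
    by_cases hb : b ∈ Bl i
    · obtain ⟨S, hS⟩ := exists_subset_card_eq (mem_filter.1 hb).2
      exact ⟨S, fun _ => hS⟩
    · exact ⟨∅, fun h => absurd h hb⟩
  choose N' hN' using hch
  have hN'N : ∀ b ∈ Bl i, N' b ⊆ N b := fun b hb => (hN' b hb).1.trans inter_subset_left
  refine (hasBalancedSub_of_dyadic (A := Al i) (κ := κ) (τ := τ i) (δ := δ i) hr hBlne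
    (fun S hS => (card_le_card fun b hb => ?_).trans_lt (hK S hS))
    (fun b hb => (hN' b hb).1.trans inter_subset_right) (fun b hb => (hN' b hb).2)
    (fun a ha => ?_) (hδτ i) (hδ i) hκ hrκ ?_).mono hBlB hN'N
  · rw [mem_filter] at hb ⊢
    exact ⟨hBlB hb.1, hb.2.trans (hN'N b hb.1)⟩
  · rw [← hτ]
    refine (card_le_card fun b hb => ?_).trans (mem_filter.1 ha).2.2
    rw [mem_filter] at hb ⊢
    exact ⟨hBlB hb.1, hN'N b hb.1 hb.2⟩
  · have h1 : #(Al i) * 2 ^ τ i ≤ ∑ a ∈ Al i, deg a :=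
      card_nsmul_le_sum _ _ _ fun a ha => (mem_filter.1 ha).2.1.le
    have h2 : ∑ a ∈ Al i, deg a ≤ ∑ a ∈ A, deg a := sum_le_sum_of_subset (filter_subset _ _)
    have h3 : ∑ b ∈ B₀, #(N b) ≤ #B₀ * d := sum_le_card_nsmul _ _ _ hN
    rw [← sum_degree_eq hNA] at h3
    have h4 : #B₀ * d ≤ 2 * (c * #(Bl i)) * d := Nat.mul_le_mul_right _ (by omega)
    have h5 : 8 * c * d * #(Bl i) ≤ 2 ^ κ * #(Bl i) := Nat.mul_le_mul_right _ hcd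
    have h6 : #(Al i) * 2 ^ τ i ≤ 2 * (c * #(Bl i)) * d := h1.trans (h2.trans (h3.trans h4))
    nlinarith

omit [DecidableEq β] in
lemma hasBalancedSub_of_biclique {B : Finset β} {N : β → Finset α} {r : ℕ} (hr : 0 < r)
    {S : Finset α} (hS : #S = r) (h : r ≤ #{b ∈ B | S ⊆ N b}) : HasBalancedSub N B r := by
  obtain ⟨T, hT, hTr⟩ := exists_subset_card_eq h
  refine ⟨S, T, fun _ => S, hT.trans (filter_subset _ _), fun b hb => (mem_filter.1 (hT hb)).2,
    fun _ _ => subset_rfl, fun _ _ => hS.le, fun a _ => ?_, ?_⟩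
  · exact (card_le_card (filter_subset _ _)).trans hTr.le
  · rw [sum_const, hS, hTr, smul_eq_mul]
    nlinarith

/-- The exponent `κ = ⌈log₂ (8 d ^ 2)⌉` is of smaller order than `d / r ^ 3`. -/
lemma clog_bound {r d : ℕ} (hr : 0 < r) (hd : 160000 * r ^ 4 ≤ d) :
    2 * (12 * r * (16 * r ^ 2 * Nat.clog 2 (8 * d ^ 2) + 2) + 1) ≤ d := by
  obtain ⟨m, hm, hm'⟩ : ∃ m, m ^ 4 ≤ d ∧ d < (m + 1) ^ 4 :=
    ⟨Nat.nthRoot 4 d, (Nat.le_nthRoot_iff (by norm_num)).1 le_rfl,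
      Nat.lt_pow_nthRoot_add_one (by norm_num) d⟩
  have hrm : 20 * r ≤ m := by
    by_contra! h
    have h1 : (m + 1) ^ 4 ≤ (20 * r) ^ 4 := Nat.pow_le_pow_left h 4
    have h2 : (20 * r) ^ 4 = 160000 * r ^ 4 := by ring
    omega
  have hκ : Nat.clog 2 (8 * d ^ 2) ≤ 8 * m + 3 := by
    refine Nat.clog_le_of_le_pow ?_
    have h1 : m + 1 ≤ 2 ^ m := Nat.lt_two_pow_self
    have h2 : d ≤ (2 ^ m) ^ 4 := hm'.le.trans (Nat.pow_le_pow_left h1 4)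
    calc 8 * d ^ 2 ≤ 8 * ((2 ^ m) ^ 4) ^ 2 := by gcongr
      _ = 2 ^ (8 * m + 3) := by rw [← pow_mul, ← pow_mul, pow_add]; ring
  refine le_trans ?_ hm
  have h1 : 12 * r * (16 * r ^ 2 * Nat.clog 2 (8 * d ^ 2) + 2) + 1
      ≤ 12 * r * (16 * r ^ 2 * (8 * m + 3) + 2) + 1 := by gcongr
  have h2 : 8000 * r ^ 3 ≤ m ^ 3 := by
    calc 8000 * r ^ 3 = (20 * r) ^ 3 := by ring
      _ ≤ m ^ 3 := Nat.pow_le_pow_left hrm 3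
  have h3 := Nat.mul_le_mul_right m h2
  have h4 : m ^ 3 * 20 ≤ m ^ 3 * m := Nat.mul_le_mul_left _ (by omega)
  have h5 : m * 20 ^ 3 ≤ m * m ^ 3 := Nat.mul_le_mul_left _ (Nat.pow_le_pow_left (by omega) 3)
  nlinarith

/-- A bipartite incidence structure in which every `b` has `d` neighbours, where `d` is at
least a constant times `r ^ 4` times the iterated logarithm of the size, has a balanced
substructure. -/
lemma hasBalancedSub_of_card_le {A : Finset α} {B : Finset β} {N : β → Finset α} {r d ℓ : ℕ}
    (hr : 8 ≤ r) (hℓ : 0 < ℓ) (hB : B.Nonempty) (hNA : ∀ b ∈ B, N b ⊆ A)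
    (hN : ∀ b ∈ B, #(N b) = d) (hAB : #A ≤ #B) (hBℓ : #B ≤ 2 ^ 2 ^ ℓ)
    (hd : 160000 * r ^ 4 * ℓ ≤ d) : HasBalancedSub N B r := by
  by_cases hK : ∃ S : Finset α, #S = r ∧ r ≤ #{b ∈ B | S ⊆ N b}
  · obtain ⟨S, hS, h⟩ := hK
    exact hasBalancedSub_of_biclique (by omega) hS h
  push Not at hK
  have hd' : 160000 * r ^ 4 ≤ d := le_trans (Nat.le_mul_of_pos_right _ hℓ) hd
  have hnum := clog_bound (by omega) hd'
  set κ := Nat.clog 2 (8 * d ^ 2) with hκdef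
  have hκpow : 8 * d ^ 2 ≤ 2 ^ κ := Nat.le_pow_clog (by norm_num) _
  have hrd : r ≤ d := le_trans (by
    calc r ≤ r ^ 4 := Nat.le_self_pow (by norm_num) _
      _ ≤ 160000 * r ^ 4 := Nat.le_mul_of_pos_left _ (by norm_num)) hd'
  have hκ : 0 < κ := by
    by_contra! h
    have h0 : κ = 0 := by omega
    rw [h0] at hκpow
    nlinarith
  obtain ⟨τ, δ, hτ0, hτ, hδτ, hδ, hτℓ⟩ :=
    exists_growth_sequence (K := 16 * r ^ 2) (by positivity) hκ ℓ
  have hdeg : ∀ a, #{b ∈ B | a ∈ N b} ≤ 2 ^ τ (2 * (16 * r ^ 2) * ℓ) := fun a =>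
    (card_le_card (filter_subset _ _)).trans
      (hBℓ.trans (Nat.pow_le_pow_right (by norm_num) hτℓ))
  set Bh := {b ∈ B | d < 2 * #{a ∈ N b | 2 ^ τ 0 < #{b ∈ B | a ∈ N b}}} with hBh
  have hsplit := card_filter_add_card_filter_not (s := B)
    (fun b => d < 2 * #{a ∈ N b | 2 ^ τ 0 < #{b ∈ B | a ∈ N b}})
  rw [← hBh] at hsplit
  set Bl := {b ∈ B | ¬ d < 2 * #{a ∈ N b | 2 ^ τ 0 < #{b ∈ B | a ∈ N b}}} with hBl
  have hBpos := hB.card_pos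
  rcases le_total #B (2 * #Bh) with h | h
  · have hBh0 : 0 < #Bh := by omega
    refine hasBalancedSub_of_high_degree (c := 2 * (16 * r ^ 2) * ℓ) hr
      (card_pos.1 hBh0) (filter_subset _ _) h hK hNA (fun b hb => (hN b hb).le) ?_ hτ hδτ hδ
      hκ ?_ ?_ fun a _ => hdeg a
    · intro b hb
      have h1 := (mem_filter.1 hb).2
      have h2 : 2 * (2 * (16 * r ^ 2) * ℓ * (2 * r ^ 2)) ≤ 160000 * r ^ 4 * ℓ := by
        have : 2 * (2 * (16 * r ^ 2) * ℓ * (2 * r ^ 2)) = 128 * (r ^ 4 * ℓ) := by ring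
        rw [this, mul_assoc]
        gcongr
        norm_num
      omega
    · nlinarith
    · have h1 : 2 * (16 * r ^ 2) * ℓ ≤ d := by
        refine (Nat.mul_le_mul_right _ ?_).trans hd
        have : r ^ 2 * 1 ≤ r ^ 2 * r ^ 2 := Nat.mul_le_mul_left _ (Nat.one_le_pow _ _ (by omega))
        nlinarith
      calc 8 * (2 * (16 * r ^ 2) * ℓ) * d ≤ 8 * d * d := by gcongr
        _ = 8 * d ^ 2 := by ring
        _ ≤ 2 ^ κ := hκpow
  · set Al := {a ∈ A | #{b ∈ B | a ∈ N b} ≤ 2 ^ τ 0}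
    have hBlB : Bl ⊆ B := filter_subset _ _
    refine (hasBalancedSub_of_degree_le hr (2 ^ τ 0) (τ 0 + 2) Al Bl (fun b => N b ∩ Al)
      (card_pos.1 (by omega)) (fun _ _ => inter_subset_right) ?_ ?_ ?_ ?_).mono hBlB
      fun _ _ => inter_subset_left
    · intro b hb
      obtain ⟨hbB, hb'⟩ := mem_filter.1 hb
      have h1 := card_filter_add_card_filter_not (s := N b)
        (fun a => 2 ^ τ 0 < #{b ∈ B | a ∈ N b})
      have h2 : #{a ∈ N b | ¬ 2 ^ τ 0 < #{b ∈ B | a ∈ N b}} ≤ #(N b ∩ Al) := by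
        refine card_le_card fun a ha => ?_
        rw [mem_filter, not_lt] at ha
        exact mem_inter.2 ⟨ha.1, mem_filter.2 ⟨hNA b hbB ha.1, ha.2⟩⟩
      rw [hN b hbB] at h1
      rw [hτ0]
      omega
    · intro a ha
      refine (card_le_card fun b hb => ?_).trans (mem_filter.1 ha).2
      rw [mem_filter] at hb ⊢
      exact ⟨hBlB hb.1, (mem_inter.1 hb.2).1⟩
    · have h1 : 2 ^ τ 0 * #Al ≤ 2 ^ τ 0 * (2 * #Bl) :=
        Nat.mul_le_mul_left _ ((card_le_card (filter_subset _ _)).trans (by omega))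
      have h2 : 0 < 2 ^ τ 0 * #Bl := Nat.mul_pos (by positivity) (by omega)
      rw [pow_add]
      nlinarith
    · exact (card_le_card (filter_subset _ _)).trans (by omega)

end Bipartite

section Graph

open Finset

variable [Fintype V] [DecidableEq V]

omit [DecidableEq V] in
/-- A vertex set inducing a subgraph of `H ≤ G` with degrees in `[r / 64, r]`. -/
lemma hasAlmostRegularSubgraph_of_le {G H : SimpleGraph V} [DecidableRel H.Adj] (hHG : H ≤ G)
    {S : Finset V} (hS : S.Nonempty) {r : ℕ} {c : ℝ}
    (hmax : ∀ v ∈ S, #{w ∈ S | H.Adj v w} ≤ r) (hmin : ∀ v ∈ S, r ≤ 64 * #{w ∈ S | H.Adj v w})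
    (hc : c * #S ≤ ∑ v ∈ S, #{w ∈ S | H.Adj v w}) : HasAlmostRegularSubgraph G 64 c := by
  classical
  set K : G.Subgraph :=
    { verts := S
      Adj := fun u v => u ∈ S ∧ v ∈ S ∧ H.Adj u v
      adj_sub := fun h => hHG h.2.2
      edge_vert := fun h => h.1
      symm := ⟨fun _ _ h => ⟨h.2.1, h.1, h.2.2.symm⟩⟩ } with hK
  have hnbr : ∀ v ∈ S, K.neighborSet v = ({w ∈ S | H.Adj v w} : Finset V) := by
    intro v hv
    ext w
    simp [hK, SimpleGraph.Subgraph.neighborSet, hv]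
  have hdeg : ∀ v ∈ S, subDeg K v = #{w ∈ S | H.Adj v w} := by
    intro v hv
    rw [subDeg, hnbr v hv, Set.ncard_coe_finset]
  have hedge : 2 * subEdgeCount K = ∑ v ∈ S, #{w ∈ S | H.Adj v w} := by
    have h1 := K.spanningCoe.sum_degrees_eq_twice_card_edges
    have h2 : subEdgeCount K = #K.spanningCoe.edgeFinset := by
      rw [subEdgeCount, ← Set.ncard_coe_finset, SimpleGraph.coe_edgeFinset,
        SimpleGraph.Subgraph.edgeSet_spanningCoe]
    rw [h2, ← h1, ← sum_subset (subset_univ S)]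
    · refine sum_congr rfl fun v hv => ?_
      rw [← SimpleGraph.card_neighborFinset_eq_degree]
      congr 1
      ext w
      simp [hK, hv]
    · intro v _ hv
      rw [← SimpleGraph.card_neighborFinset_eq_degree, card_eq_zero, eq_empty_iff_forall_notMem]
      intro w hw
      simp [hK, hv] at hw
  have hSpos : (0 : ℝ) < #S := by exact_mod_cast hS.card_pos
  refine ⟨K, hS, fun v hv w hw => ?_, ?_⟩
  · rw [hdeg v hv, hdeg w hw]
    exact_mod_cast (hmax v hv).trans (hmin w hw)
  · have h1 : (2 : ℝ) * subEdgeCount K = ∑ v ∈ S, (#{w ∈ S | H.Adj v w} : ℝ) := by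
      exact_mod_cast hedge
    have h2 : K.verts.ncard = #S := Set.ncard_coe_finset S
    rw [subAvgDeg, h1, h2, le_div_iff₀ hSpos]
    exact_mod_cast hc

omit [Fintype V] in
lemma sum_degree_erase (H : SimpleGraph V) [DecidableRel H.Adj] {S : Finset V} {v : V}
    (hv : v ∈ S) : ∑ u ∈ S, #{w ∈ S | H.Adj u w} =
      ∑ u ∈ S.erase v, #{w ∈ S.erase v | H.Adj u w} + 2 * #{w ∈ S | H.Adj v w} := by
  have h1 : ∀ u, #{w ∈ S | H.Adj u w} = #{w ∈ S.erase v | H.Adj u w}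
      + if H.Adj u v then 1 else 0 := by
    intro u
    rw [filter_erase]
    split_ifs with h
    · rw [card_erase_add_one (mem_filter.2 ⟨hv, h⟩)]
    · rw [erase_eq_of_notMem fun h' => h (mem_filter.1 h').2, add_zero]
  have h2 : #{w ∈ S | H.Adj v w} = ∑ u ∈ S.erase v, if H.Adj u v then 1 else 0 := by
    rw [h1 v, if_neg (H.loopless.irrefl v), add_zero, card_filter]
    exact sum_congr rfl fun u _ => by simp only [H.adj_comm]
  rw [← sum_erase_add _ _ hv, sum_congr rfl fun u _ => h1 u, sum_add_distrib, ← h2]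
  ring

/-- A graph with maximum degree `r` and average degree above `r / 10` has an almost regular
subgraph. -/
lemma hasAlmostRegularSubgraph_of_degree_le {G H : SimpleGraph V} [DecidableRel H.Adj]
    (hHG : H ≤ G) {S₀ : Finset V} {r : ℕ} (hmax : ∀ v ∈ S₀, #{w ∈ S₀ | H.Adj v w} ≤ r)
    (hS₀ : r * #S₀ < 10 * ∑ v ∈ S₀, #{w ∈ S₀ | H.Adj v w}) :
    HasAlmostRegularSubgraph G 64 (r / 10) := by
  set F : Finset (Finset V) :=
    {S ∈ S₀.powerset | r * #S < 10 * ∑ v ∈ S, #{w ∈ S | H.Adj v w}} with hF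
  obtain ⟨S, hSF, hmin⟩ := exists_min_image F card
    ⟨S₀, mem_filter.2 ⟨mem_powerset_self _, hS₀⟩⟩
  obtain ⟨hSS₀, hS⟩ := mem_filter.1 hSF
  rw [mem_powerset] at hSS₀
  have hdeg : ∀ v ∈ S, r < 20 * #{w ∈ S | H.Adj v w} := by
    intro v hv
    by_contra! hcon
    have h1 := sum_degree_erase H hv
    have h2 := card_erase_add_one hv
    have hmem : S.erase v ∈ F := by
      refine mem_filter.2 ⟨mem_powerset.2 ((erase_subset _ _).trans hSS₀), ?_⟩
      rw [h1, ← h2] at hS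
      nlinarith
    have := hmin _ hmem
    omega
  refine hasAlmostRegularSubgraph_of_le hHG (S := S) ?_ (r := r)
    (fun v hv => ?_) (fun v hv => ?_) ?_
  · rw [nonempty_iff_ne_empty]
    rintro rfl
    simp at hS
  · exact (card_le_card (filter_subset_filter _ hSS₀)).trans (hmax v (hSS₀ hv))
  · have := hdeg v hv
    omega
  · have : (r : ℝ) * #S ≤ 10 * ((∑ v ∈ S, #{w ∈ S | H.Adj v w} : ℕ) : ℝ) := by
      exact_mod_cast hS.le
    linarith

/-- A balanced substructure of a bipartite subgraph of `G` is an almost regular subgraph. -/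
lemma HasBalancedSub.hasAlmostRegularSubgraph {G : SimpleGraph V} {X Y : Finset V}
    (hXY : Disjoint X Y) {N : V → Finset V} (hNX : ∀ b ∈ Y, N b ⊆ X)
    (hNG : ∀ b ∈ Y, ∀ a ∈ N b, G.Adj a b) {r : ℕ} (h : HasBalancedSub N Y r) :
    HasAlmostRegularSubgraph G 64 (r / 10) := by
  classical
  obtain ⟨A, B, N', hBY, hN'N, hN'A, hN'r, hAr, hcard⟩ := h
  have hN'X : ∀ b ∈ B, N' b ⊆ X := fun b hb => (hN'N b hb).trans (hNX b (hBY hb))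
  have hdisj : Disjoint (A ∩ X) B :=
    disjoint_of_subset_left inter_subset_right (disjoint_of_subset_right hBY hXY)
  have hXB : ∀ a ∈ X, a ∉ B := fun a ha hb => disjoint_left.1 hXY ha (hBY hb)
  set H : SimpleGraph V :=
    { Adj := fun u v => (v ∈ B ∧ u ∈ N' v) ∨ (u ∈ B ∧ v ∈ N' u)
      symm := ⟨fun _ _ h => h.symm⟩
      loopless := ⟨fun v h => by
        rcases h with h | h <;> exact hXB v (hN'X v h.1 h.2) h.1⟩ } with hH
  have hHG : H ≤ G := by
    rintro u v (⟨hv, hu⟩ | ⟨hu, hv⟩)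
    · exact hNG v (hBY hv) u (hN'N v hv hu)
    · exact (hNG u (hBY hu) v (hN'N u hu hv)).symm
  have hdegA : ∀ a ∈ A ∩ X, #{w ∈ A ∩ X ∪ B | H.Adj a w} = #{b ∈ B | a ∈ N' b} := by
    intro a ha
    congr 1
    ext w
    have haB := hXB a (mem_inter.1 ha).2
    simp only [hH, mem_filter, mem_union]
    tauto
  have hdegB : ∀ b ∈ B, #{w ∈ A ∩ X ∪ B | H.Adj b w} = #(N' b) := by
    intro b hb
    congr 1
    ext w
    have h1 : w ∈ N' b → w ∈ A ∩ X := fun h => mem_inter.2 ⟨hN'A b hb h, hN'X b hb h⟩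
    have h2 : w ∈ B → b ∉ N' w := fun hw h => hXB b (hN'X w hw h) hb
    simp only [hH, mem_filter, mem_union]
    tauto
  refine hasAlmostRegularSubgraph_of_degree_le hHG (S₀ := A ∩ X ∪ B) (fun v hv => ?_) ?_
  · rcases mem_union.1 hv with hv | hv
    · rw [hdegA v hv]
      exact hAr v (mem_inter.1 hv).1
    · rw [hdegB v hv]
      exact hN'r v hv
  · rw [sum_union hdisj, sum_congr rfl hdegA, sum_congr rfl hdegB, card_union_of_disjoint hdisj,
      sum_degree_eq fun b hb => subset_inter (hN'A b hb) (hN'X b hb)]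
    have h1 : r * (#(A ∩ X) + #B) ≤ r * (#A + #B) :=
      Nat.mul_le_mul_left _ (Nat.add_le_add_right (card_le_card inter_subset_left) _)
    omega

omit [Fintype V] in
/-- Half of the edges of a graph go across some partition of the vertices. -/
lemma exists_large_cut (G : SimpleGraph V) [DecidableRel G.Adj] (S : Finset V) :
    ∃ X Y : Finset V, Disjoint X Y ∧ X ∪ Y = S ∧
      ∑ v ∈ S, #{w ∈ S | G.Adj v w} ≤ 4 * ∑ x ∈ X, #{y ∈ Y | G.Adj x y} := by
  induction S using Finset.induction_on with
  | empty => exact ⟨∅, ∅, by simp⟩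
  | insert a S ha ih =>
    obtain ⟨X, Y, hXY, rfl, h⟩ := ih
    have h1 := sum_degree_erase G (mem_insert_self a (X ∪ Y))
    rw [erase_insert ha] at h1
    have h2 : #{w ∈ insert a (X ∪ Y) | G.Adj a w}
        = #{w ∈ X | G.Adj a w} + #{w ∈ Y | G.Adj a w} := by
      rw [filter_insert, if_neg (G.loopless.irrefl a), filter_union,
        card_union_of_disjoint (disjoint_filter_filter hXY)]
    rw [mem_union, not_or] at ha
    rcases le_total #{w ∈ X | G.Adj a w} #{w ∈ Y | G.Adj a w} with hle | hle
    · refine ⟨insert a X, Y, disjoint_insert_left.2 ⟨ha.2, hXY⟩, insert_union _ _ _, ?_⟩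
      rw [sum_insert ha.1]
      omega
    · refine ⟨X, insert a Y, disjoint_insert_right.2 ⟨ha.1, hXY⟩, union_insert _ _ _, ?_⟩
      have h3 : ∑ x ∈ X, #{y ∈ insert a Y | G.Adj x y}
          = ∑ x ∈ X, #{y ∈ Y | G.Adj x y} + #{w ∈ X | G.Adj a w} := by
        rw [card_filter _ X, ← sum_add_distrib]
        refine sum_congr rfl fun x _ => ?_
        rw [filter_insert]
        simp only [G.adj_comm a x]
        split_ifs
        · rw [card_insert_of_notMem fun h => ha.2 (mem_filter.1 h).1]
        · rfl
      omega

/-- A graph of average degree at least `4 * k` has a bipartite subgraph of minimum degree at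
least `k`. -/
lemma exists_bipartite_min_degree (G : SimpleGraph V) [DecidableRel G.Adj] [Nonempty V] {k : ℕ}
    (hk : 4 * (k * Fintype.card V) ≤ ∑ v, G.degree v) :
    ∃ X Y : Finset V, Disjoint X Y ∧ (X ∪ Y).Nonempty ∧ (∀ x ∈ X, k ≤ #{y ∈ Y | G.Adj x y}) ∧
      ∀ y ∈ Y, k ≤ #{x ∈ X | G.Adj y x} := by
  set F : Finset (Finset V × Finset V) := {x ∈ univ ×ˢ univ | Disjoint x.1 x.2 ∧
    (x.1 ∪ x.2).Nonempty ∧ k * (#x.1 + #x.2) ≤ ∑ v ∈ x.1, #{w ∈ x.2 | G.Adj v w}} with hF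
  have hne : F.Nonempty := by
    obtain ⟨X, Y, hXY, hU, h⟩ := exists_large_cut G univ
    refine ⟨(X, Y), mem_filter.2 ⟨by simp, hXY, by rw [hU]; exact univ_nonempty, ?_⟩⟩
    have h1 : #X + #Y = Fintype.card V := by
      rw [← card_union_of_disjoint hXY, hU, card_univ]
    have h2 : ∑ v, #{w | G.Adj v w} = ∑ v, G.degree v :=
      sum_congr rfl fun v _ => by rw [← G.card_neighborFinset_eq_degree, G.neighborFinset_eq_filter]
    dsimp only
    rw [h1]
    omega
  obtain ⟨⟨X, Y⟩, hx, hmin⟩ := exists_min_image F (fun x => #x.1 + #x.2) hne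
  obtain ⟨-, hXY, hU, hcard⟩ := mem_filter.1 hx
  dsimp only at hXY hU hcard
  refine ⟨X, Y, hXY, hU, fun x hx => ?_, fun y hy => ?_⟩
  · by_contra! hcon
    have h1 := card_erase_add_one hx
    rw [← sum_erase_add _ _ hx, ← h1] at hcard
    have hlt : k * (#(X.erase x) + #Y) < ∑ v ∈ X.erase x, #{w ∈ Y | G.Adj v w} := by nlinarith
    have hmem : (X.erase x, Y) ∈ F := by
      refine mem_filter.2 ⟨by simp, disjoint_of_subset_left (erase_subset _ _) hXY, ?_, hlt.le⟩
      rw [nonempty_iff_ne_empty]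
      intro h0
      dsimp only at h0
      rw [(union_eq_empty.1 h0).1] at hlt
      simp at hlt
    have h2 := hmin _ hmem
    dsimp only at h2
    omega
  · by_contra! hcon
    have h1 := card_erase_add_one hy
    have h3 : ∑ x ∈ X, #{w ∈ Y | G.Adj x w}
        = ∑ x ∈ X, #{w ∈ Y.erase y | G.Adj x w} + #{x ∈ X | G.Adj y x} := by
      rw [card_filter _ X, ← sum_add_distrib]
      refine sum_congr rfl fun x _ => ?_
      rw [filter_erase]
      simp only [G.adj_comm y x]
      split_ifs with h
      · rw [card_erase_add_one (mem_filter.2 ⟨hy, h⟩)]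
      · rw [erase_eq_of_notMem fun h' => h (mem_filter.1 h').2, add_zero]
    rw [h3, ← h1] at hcard
    have hlt : k * (#X + #(Y.erase y)) < ∑ v ∈ X, #{w ∈ Y.erase y | G.Adj v w} := by nlinarith
    have hmem : (X, Y.erase y) ∈ F := by
      refine mem_filter.2 ⟨by simp, disjoint_of_subset_right (erase_subset _ _) hXY, ?_, hlt.le⟩
      rw [nonempty_iff_ne_empty]
      intro h0
      dsimp only at h0
      rw [(union_eq_empty.1 h0).1] at hlt
      simp at hlt
    have h2 := hmin _ hmem
    dsimp only at h2
    omega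

/-- The quantitative statement with integer parameters. -/
lemma hasAlmostRegularSubgraph_of_sum_degree (G : SimpleGraph V) [DecidableRel G.Adj]
    [Nonempty V] {r k ℓ : ℕ} (hr : 8 ≤ r) (hℓ : 0 < ℓ) (hV : Fintype.card V ≤ 2 ^ 2 ^ ℓ)
    (hk : 4 * (k * Fintype.card V) ≤ ∑ v, G.degree v) (hrk : 160000 * r ^ 4 * ℓ ≤ k) :
    HasAlmostRegularSubgraph G 64 (r / 10) := by
  have key : ∀ X Y : Finset V, Disjoint X Y → (X ∪ Y).Nonempty → #X ≤ #Y →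
      (∀ y ∈ Y, k ≤ #{x ∈ X | G.Adj y x}) → HasAlmostRegularSubgraph G 64 (r / 10) := by
    intro X Y hXY hU hle hY
    have hYne : Y.Nonempty := by
      rw [← card_pos] at hU ⊢
      have := card_union_le X Y
      omega
    have hch : ∀ y, ∃ S : Finset V, y ∈ Y → S ⊆ {x ∈ X | G.Adj y x} ∧ #S = k := by
      intro y
      by_cases hy : y ∈ Y
      · obtain ⟨S, hS⟩ := exists_subset_card_eq (hY y hy)
        exact ⟨S, fun _ => hS⟩
      · exact ⟨∅, fun h => absurd h hy⟩
    choose N hN using hch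
    have hNX : ∀ y ∈ Y, N y ⊆ X := fun y hy => (hN y hy).1.trans (filter_subset _ _)
    exact (hasBalancedSub_of_card_le hr hℓ hYne hNX (fun y hy => (hN y hy).2) hle
      ((card_le_univ _).trans hV) hrk).hasAlmostRegularSubgraph hXY hNX fun y hy x hx =>
        (mem_filter.1 ((hN y hy).1 hx)).2.symm
  obtain ⟨X, Y, hXY, hU, hX, hY⟩ := exists_bipartite_min_degree G hk
  rcases le_total #X #Y with hle | hle
  · exact key X Y hXY hU hle hY
  · exact key Y X hXY.symm (by rwa [union_comm]) hle hX

end Graph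

/-- The bound on the average degree may be weakened. -/
lemma HasAlmostRegularSubgraph.mono {G : SimpleGraph V} {K c c' : ℝ}
    (h : HasAlmostRegularSubgraph G K c) (hc : c' ≤ c) : HasAlmostRegularSubgraph G K c' :=
  let ⟨H, hne, hreg, hH⟩ := h
  ⟨H, hne, hreg, hc.trans hH⟩

/-- A single edge is an almost regular subgraph. -/
lemma hasAlmostRegularSubgraph_one_of_adj [Fintype V] {G : SimpleGraph V} {u v : V}
    (huv : G.Adj u v) : HasAlmostRegularSubgraph G 64 1 := by
  classical
  have hu : ({w ∈ {u, v} | G.Adj u w} : Finset V) = {v} := by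
    ext w
    simp only [Finset.mem_filter, Finset.mem_insert, Finset.mem_singleton]
    constructor
    · rintro ⟨rfl | rfl, h⟩
      · exact absurd h (G.loopless.irrefl _)
      · rfl
    · rintro rfl
      exact ⟨Or.inr rfl, huv⟩
  have hv : ({w ∈ {u, v} | G.Adj v w} : Finset V) = {u} := by
    ext w
    simp only [Finset.mem_filter, Finset.mem_insert, Finset.mem_singleton]
    constructor
    · rintro ⟨rfl | rfl, h⟩
      · rfl
      · exact absurd h (G.loopless.irrefl _)
    · rintro rfl
      exact ⟨Or.inl rfl, huv.symm⟩
  have hdeg : ∀ a ∈ ({u, v} : Finset V), Finset.card {w ∈ {u, v} | G.Adj a w} = 1 := by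
    intro a ha
    rcases Finset.mem_insert.1 ha with rfl | ha
    · rw [hu, Finset.card_singleton]
    · rw [Finset.mem_singleton.1 ha, hv, Finset.card_singleton]
  refine hasAlmostRegularSubgraph_of_le le_rfl (S := {u, v}) (r := 1) ⟨u, by simp⟩
    (fun a ha => (hdeg a ha).le) (fun a ha => by rw [hdeg a ha]; norm_num) ?_
  rw [Finset.sum_congr rfl fun a ha => by rw [hdeg a ha]]
  simp

lemma avgDeg_mul_card [Fintype V] [Nonempty V] (G : SimpleGraph V) [DecidableRel G.Adj] :
    avgDeg G * Fintype.card V = ((∑ v, G.degree v : ℕ) : ℝ) := by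
  classical
  have h : edgeCount G = G.edgeFinset.card := by
    rw [edgeCount, ← Set.ncard_coe_finset, SimpleGraph.coe_edgeFinset]
  have hV : (Fintype.card V : ℝ) ≠ 0 := by exact_mod_cast Fintype.card_ne_zero
  rw [avgDeg, div_mul_cancel₀ _ hV, G.sum_degrees_eq_twice_card_edges, h]
  push_cast
  ring

lemma le_two_pow_two_pow_ceil_logb_logb {n : ℕ} (hn : 1 < n) :
    n ≤ 2 ^ 2 ^ ⌈Real.logb 2 (Real.logb 2 n)⌉₊ := by
  have hn' : (1 : ℝ) < n := by exact_mod_cast hn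
  have h1 : 0 < Real.logb 2 n := Real.logb_pos one_lt_two hn'
  have h2 := (Real.logb_le_iff_le_rpow one_lt_two h1).1
    (Nat.le_ceil (Real.logb 2 (Real.logb 2 (n : ℝ))))
  rw [Real.rpow_natCast] at h2
  have h3 := (Real.logb_le_iff_le_rpow one_lt_two (by linarith)).1 h2
  rw [← Nat.cast_ofNat, ← Nat.cast_pow, Real.rpow_natCast] at h3
  exact_mod_cast h3

lemma two_le_logb_logb {n : ℝ} (hn : 16 ≤ n) : 2 ≤ Real.logb 2 (Real.logb 2 n) := by
  have h1 : 4 ≤ Real.logb 2 n := by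
    rw [Real.le_logb_iff_rpow_le one_lt_two (by linarith)]
    norm_num
    exact hn
  rw [Real.le_logb_iff_rpow_le one_lt_two (by linarith)]
  norm_num
  exact h1

/-- There is an absolute `ε > 0` such that every graph on `n ≥ 16` vertices with average
degree `d ≥ 2·log₂ log₂ n` has a `64`-almost-regular subgraph with average degree at
least `ε·(d/log₂ log₂ n)^{1/4}/(log₂(d/log₂ log₂ n))^{1/2}`. -/
theorem large_average_degree_almost_regular_subgraph :
    ∃ ε : ℝ, 0 < ε ∧
      ∀ (V : Type) [Fintype V] (G : SimpleGraph V), 16 ≤ Fintype.card V →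
        2 * Real.logb 2 (Real.logb 2 (Fintype.card V : ℝ)) ≤ avgDeg G →
        HasAlmostRegularSubgraph G 64
          (ε * (avgDeg G / Real.logb 2 (Real.logb 2 (Fintype.card V : ℝ))) ^ ((1 : ℝ) / 4) /
            (Real.logb 2
              (avgDeg G / Real.logb 2 (Real.logb 2 (Fintype.card V : ℝ)))) ^ ((1 : ℝ) / 2)) := by
  classical
  refine ⟨1 / 1000, by norm_num, fun V _ G hn hd => ?_⟩
  have hℓ : 2 ≤ Real.logb 2 (Real.logb 2 (Fintype.card V : ℝ)) :=
    two_le_logb_logb (by exact_mod_cast hn)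
  have hV := le_two_pow_two_pow_ceil_logb_logb (show 1 < Fintype.card V by omega)
  have : Nonempty V := Fintype.card_pos_iff.1 (by omega)
  have hsum := avgDeg_mul_card G
  set ℓ := Real.logb 2 (Real.logb 2 (Fintype.card V : ℝ))
  set d := avgDeg G
  set x := d / ℓ with hx
  have hxd : x * ℓ = d := div_mul_cancel₀ _ (by linarith)
  have hx2 : 2 ≤ x := by rwa [hx, le_div_iff₀ (by linarith)]
  set y := x ^ ((1 : ℝ) / 4)
  have hy0 : 0 ≤ y := by positivity
  have hy4 : y ^ 4 = x := by
    rw [← Real.rpow_natCast, ← Real.rpow_mul (by linarith)]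
    norm_num
  have hlog : 1 ≤ Real.logb 2 x ^ ((1 : ℝ) / 2) := by
    refine Real.one_le_rpow ?_ (by norm_num)
    rwa [Real.le_logb_iff_rpow_le one_lt_two (by linarith), Real.rpow_one]
  suffices h : HasAlmostRegularSubgraph G 64 (y / 1000) by
    refine h.mono ((div_le_self (by positivity) hlog).trans_eq ?_)
    ring
  set r := ⌊y / 34⌋₊
  have hry : (r : ℝ) ≤ y / 34 := Nat.floor_le (by positivity)
  have hyr : y / 34 < r + 1 := Nat.lt_floor_add_one _
  rcases lt_or_ge r 8 with hr8 | hr8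
  · obtain ⟨u, v, huv⟩ : ∃ u v, G.Adj u v := by
      by_contra! hcon
      have h0 : ∑ v, G.degree v = 0 := Finset.sum_eq_zero fun v _ => by
        rw [← G.card_neighborFinset_eq_degree, Finset.card_eq_zero,
          Finset.eq_empty_iff_forall_notMem]
        simp [hcon]
      have hn' : (16 : ℝ) ≤ Fintype.card V := by exact_mod_cast hn
      rw [h0, Nat.cast_zero] at hsum
      nlinarith
    refine (hasAlmostRegularSubgraph_one_of_adj huv).mono ?_
    have : (r : ℝ) ≤ 7 := by exact_mod_cast Nat.le_of_lt_succ hr8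
    linarith
  · have hr8' : (8 : ℝ) ≤ r := by exact_mod_cast hr8
    refine (hasAlmostRegularSubgraph_of_sum_degree G (k := ⌊d / 4⌋₊) hr8 (ℓ := ⌈ℓ⌉₊)
      (Nat.ceil_pos.2 (by linarith)) hV ?_ (Nat.le_floor ?_)).mono (by linarith)
    · have h1 : (⌊d / 4⌋₊ : ℝ) ≤ d / 4 := Nat.floor_le (by nlinarith)
      have h2 : 4 * ((⌊d / 4⌋₊ : ℝ) * Fintype.card V) ≤ ((∑ v, G.degree v : ℕ) : ℝ) := by
        rw [← hsum]
        nlinarith [(Nat.cast_nonneg (Fintype.card V) : (0 : ℝ) ≤ _)]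
      exact_mod_cast h2
    · have h1 : (⌈ℓ⌉₊ : ℝ) ≤ 2 * ℓ := by linarith [Nat.ceil_lt_add_one (show 0 ≤ ℓ by linarith)]
      have h2 : (r : ℝ) ^ 4 ≤ x / 1336336 :=
        (pow_le_pow_left₀ (Nat.cast_nonneg r) hry 4).trans_eq (by rw [div_pow, hy4]; norm_num)
      have h3 : (r : ℝ) ^ 4 * ⌈ℓ⌉₊ ≤ x / 1336336 * (2 * ℓ) :=
        mul_le_mul h2 h1 (Nat.cast_nonneg _) (by positivity)
      push_cast
      nlinarith
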